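/- If (G,(s_1,t_1),(s_2,t_2)) contains no subgraph which is a Bad Configuration, then (G,(s_1,t_1),(s_2,t_2)) is strongly efficient: for every nonnegative cost function c, every optimal Steiner forest is enforceable. -/

import Mathlib

namespace NDG

variable {V : Type*} [DecidableEq V]

/-- Total cost of a finite set of edges. -/
def cost (c : Sym2 V → ℝ) (F : Finset (Sym2 V)) : ℝ := ∑ e ∈ F, c e

/-- A Steiner forest: an acyclic set of edges of `G` connecting both
terminal pairs. -/
def IsSteinerForest (G : SimpleGraph V) (s₁ t₁ s₂ t₂ : V) (F : Finset (Sym2 V)) : Prop :=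
  (↑F ⊆ G.edgeSet) ∧
  (SimpleGraph.fromEdgeSet (↑F : Set (Sym2 V))).IsAcyclic ∧
  (∃ p : G.Walk s₁ t₁, p.IsPath ∧ ∀ e ∈ p.edges, e ∈ F) ∧
  (∃ p : G.Walk s₂ t₂, p.IsPath ∧ ∀ e ∈ p.edges, e ∈ F)

/-- An optimal Steiner forest: one of minimum total cost. -/
def IsOptimalSteinerForest (G : SimpleGraph V) (s₁ t₁ s₂ t₂ : V) (c : Sym2 V → ℝ)
    (F : Finset (Sym2 V)) : Prop :=
  IsSteinerForest G s₁ t₁ s₂ t₂ F ∧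
  ∀ F', IsSteinerForest G s₁ t₁ s₂ t₂ F' → cost c F ≤ cost c F'

/-- A strategy of a player: a simple path between her terminals. -/
abbrev Strat (G : SimpleGraph V) (s t : V) := {p : G.Walk s t // p.IsPath}

/-- A cost sharing protocol: cost shares for both players on every edge,
depending on the chosen strategy profile. -/
abbrev Protocol (G : SimpleGraph V) (s₁ t₁ s₂ t₂ : V) :=
  Strat G s₁ t₁ → Strat G s₂ t₂ → Fin 2 → Sym2 V → ℝ

/-- The set of players using edge `e` in the profile `(P₁, P₂)`. -/
def usedBy {G : SimpleGraph V} {s₁ t₁ s₂ t₂ : V}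
    (P₁ : Strat G s₁ t₁) (P₂ : Strat G s₂ t₂) (e : Sym2 V) : Finset (Fin 2) :=
  (if e ∈ P₁.1.edges then {0} else ∅) ∪ (if e ∈ P₂.1.edges then {1} else ∅)

/-- The total cost player 1 pays. -/
def cost₁ {G : SimpleGraph V} {s₁ t₁ s₂ t₂ : V} (Ξ : Protocol G s₁ t₁ s₂ t₂)
    (P₁ : Strat G s₁ t₁) (P₂ : Strat G s₂ t₂) : ℝ :=
  ∑ e ∈ P₁.1.edges.toFinset, Ξ P₁ P₂ 0 e

/-- The total cost player 2 pays. -/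
def cost₂ {G : SimpleGraph V} {s₁ t₁ s₂ t₂ : V} (Ξ : Protocol G s₁ t₁ s₂ t₂)
    (P₁ : Strat G s₁ t₁) (P₂ : Strat G s₂ t₂) : ℝ :=
  ∑ e ∈ P₂.1.edges.toFinset, Ξ P₁ P₂ 1 e

/-- Pure Nash equilibrium of the two-player game induced by the protocol `Ξ`. -/
def IsPNE {G : SimpleGraph V} {s₁ t₁ s₂ t₂ : V} (Ξ : Protocol G s₁ t₁ s₂ t₂)
    (P₁ : Strat G s₁ t₁) (P₂ : Strat G s₂ t₂) : Prop :=
  (∀ Q₁, cost₁ Ξ P₁ P₂ ≤ cost₁ Ξ Q₁ P₂) ∧ (∀ Q₂, cost₂ Ξ P₁ P₂ ≤ cost₂ Ξ P₁ Q₂)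

/-- A separable cost sharing protocol: nonnegative, budget-balanced, stable and
separable (cost shares on an edge depend only on the set of players using it). -/
structure IsSeparable {G : SimpleGraph V} {s₁ t₁ s₂ t₂ : V} (c : Sym2 V → ℝ)
    (Ξ : Protocol G s₁ t₁ s₂ t₂) : Prop where
  nonneg : ∀ P₁ P₂ i e, 0 ≤ Ξ P₁ P₂ i e
  budget : ∀ P₁ P₂ e, (usedBy P₁ P₂ e).Nonempty →
    ∑ i ∈ usedBy P₁ P₂ e, Ξ P₁ P₂ i e = c e
  stable : ∃ P₁ P₂, IsPNE Ξ P₁ P₂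
  separable : ∀ P₁ P₂ Q₁ Q₂ e, usedBy P₁ P₂ e = usedBy Q₁ Q₂ e →
    ∀ i, Ξ P₁ P₂ i e = Ξ Q₁ Q₂ i e

/-- A Steiner forest `F` is enforceable if the profile of the unique paths of
the two players inside `F` is a pure Nash equilibrium of the game induced by
some separable cost sharing protocol. -/
def Enforceable (G : SimpleGraph V) (s₁ t₁ s₂ t₂ : V) (c : Sym2 V → ℝ)
    (F : Finset (Sym2 V)) : Prop :=
  ∃ (P₁ : Strat G s₁ t₁) (P₂ : Strat G s₂ t₂),
    (∀ e ∈ P₁.1.edges, e ∈ F) ∧ (∀ e ∈ P₂.1.edges, e ∈ F) ∧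
    (∀ Q₁ : Strat G s₁ t₁, (∀ e ∈ Q₁.1.edges, e ∈ F) → Q₁ = P₁) ∧
    (∀ Q₂ : Strat G s₂ t₂, (∀ e ∈ Q₂.1.edges, e ∈ F) → Q₂ = P₂) ∧
    ∃ Ξ : Protocol G s₁ t₁ s₂ t₂, IsSeparable c Ξ ∧ IsPNE Ξ P₁ P₂

/-- `(G,(s₁,t₁),(s₂,t₂))` is efficient: for every nonnegative cost function
some optimal Steiner forest is enforceable (the PoS is 1). -/
def Efficient (G : SimpleGraph V) (s₁ t₁ s₂ t₂ : V) : Prop :=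
  ∀ c : Sym2 V → ℝ, (∀ e, 0 ≤ c e) →
    ∃ F, IsOptimalSteinerForest G s₁ t₁ s₂ t₂ c F ∧ Enforceable G s₁ t₁ s₂ t₂ c F

/-- `(G,(s₁,t₁),(s₂,t₂))` is strongly efficient: for every nonnegative cost
function every optimal Steiner forest is enforceable. -/
def StronglyEfficient (G : SimpleGraph V) (s₁ t₁ s₂ t₂ : V) : Prop :=
  ∀ c : Sym2 V → ℝ, (∀ e, 0 ≤ c e) →
    ∀ F, IsOptimalSteinerForest G s₁ t₁ s₂ t₂ c F → Enforceable G s₁ t₁ s₂ t₂ c F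

/-- A preliminary bad configuration (PBC) for the terminal pairs `(u,v)` and
`(w,x)`: the path `P_u = Lu ++ M ++ Ru` of one player and the path
`P_ℓ = Ll ++ M ++ Rl` of the other player meet exactly in the nonempty,
consistently oriented common subpath `M`; `q₁` closes a unique cycle with `P_u`
(intersecting it in the segment `S1`, which contains edges of `R_u` and of `M`),
`q₂` and `q₃` close unique cycles with `P_ℓ` (intersecting it in the segments
`S2` resp. `S3`, containing edges of `L_ℓ` resp. `R_ℓ` and of `M`, and missing
part of `M`); moreover `C := C₂ ∩ C₃ ∩ M` is nonempty and contained in `C₁`, and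
`(M ∩ C₁ ∩ C₂) \ C` and `(M ∩ C₁ ∩ C₃) \ C` each contain an edge. -/
structure PBC (G : SimpleGraph V) (u v w x : V) where
  a : V
  b : V
  Lu : G.Walk u a
  M : G.Walk a b
  Ru : G.Walk b v
  Ll : G.Walk w a
  Rl : G.Walk b x
  hM_ne : M.edges ≠ []
  hPu : ((Lu.append M).append Ru).IsPath
  hPl : ((Ll.append M).append Rl).IsPath
  hforest : (SimpleGraph.fromEdgeSet
      {e | e ∈ ((Lu.append M).append Ru).edges ∨ e ∈ ((Ll.append M).append Rl).edges}).IsAcyclic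
  hmeet : ∀ e, e ∈ ((Lu.append M).append Ru).edges →
      e ∈ ((Ll.append M).append Rl).edges → e ∈ M.edges
  hRu_ne : Ru.edges ≠ []
  hLl_ne : Ll.edges ≠ []
  hRl_ne : Rl.edges ≠ []
  a1 : V
  b1 : V
  q1 : G.Walk a1 b1
  S1 : G.Walk a1 b1
  hq1path : q1.IsPath
  hq1_ne : q1.edges ≠ []
  hS1 : S1.darts <:+: ((Lu.append M).append Ru).darts
  hq1closes : ∀ y ∈ q1.support, y ∈ ((Lu.append M).append Ru).support → y = a1 ∨ y = b1
  hC1Ru : ∃ e ∈ S1.edges, e ∈ Ru.edges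
  hC1M : ∃ e ∈ S1.edges, e ∈ M.edges
  a2 : V
  b2 : V
  q2 : G.Walk a2 b2
  S2 : G.Walk a2 b2
  hq2path : q2.IsPath
  hq2_ne : q2.edges ≠ []
  hS2 : S2.darts <:+: ((Ll.append M).append Rl).darts
  hq2closes : ∀ y ∈ q2.support, y ∈ ((Ll.append M).append Rl).support → y = a2 ∨ y = b2
  hC2Ll : ∃ e ∈ S2.edges, e ∈ Ll.edges
  hC2M : ∃ e ∈ S2.edges, e ∈ M.edges
  hMC2 : ∃ e ∈ M.edges, e ∉ S2.edges
  a3 : V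
  b3 : V
  q3 : G.Walk a3 b3
  S3 : G.Walk a3 b3
  hq3path : q3.IsPath
  hq3_ne : q3.edges ≠ []
  hS3 : S3.darts <:+: ((Ll.append M).append Rl).darts
  hq3closes : ∀ y ∈ q3.support, y ∈ ((Ll.append M).append Rl).support → y = a3 ∨ y = b3
  hC3Rl : ∃ e ∈ S3.edges, e ∈ Rl.edges
  hC3M : ∃ e ∈ S3.edges, e ∈ M.edges
  hMC3 : ∃ e ∈ M.edges, e ∉ S3.edges
  hC_ne : ∃ e ∈ M.edges, e ∈ S2.edges ∧ e ∈ S3.edges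
  hC_sub : ∀ e ∈ M.edges, e ∈ S2.edges → e ∈ S3.edges → e ∈ S1.edges
  hC1C2 : ∃ e ∈ M.edges, e ∈ S1.edges ∧ e ∈ S2.edges ∧ e ∉ S3.edges
  hC1C3 : ∃ e ∈ M.edges, e ∈ S1.edges ∧ e ∈ S3.edges ∧ e ∉ S2.edges

namespace PBC

variable {G : SimpleGraph V} {u v w x : V}

/-- The path of the "upper" player (terminals `u`, `v`). -/
def Pu (B : PBC G u v w x) : G.Walk u v := (B.Lu.append B.M).append B.Ru

/-- The path of the "lower" player (terminals `w`, `x`). -/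
def Pl (B : PBC G u v w x) : G.Walk w x := (B.Ll.append B.M).append B.Rl

/-- `q₁` is small: the cycle `C₁` contains no edge of `L_u`. -/
def Small (B : PBC G u v w x) : Prop := ∀ e ∈ B.S1.edges, e ∉ B.Lu.edges

/-- `q₁` is big: the cycle `C₁` contains an edge of `L_u`. -/
def Big (B : PBC G u v w x) : Prop := ∃ e ∈ B.S1.edges, e ∈ B.Lu.edges

/-- Node-disjointness of two walks. -/
def NodeDisj {y z y' z' : V} (p : G.Walk y z) (q : G.Walk y' z') : Prop :=
  ∀ s ∈ p.support, s ∉ q.support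

/-- `q` is internally node-disjoint from `P_u ∪ P_ℓ`. -/
def InternDisj (B : PBC G u v w x) {y z : V} (q : G.Walk y z) : Prop :=
  ∀ s ∈ q.support, s ≠ y → s ≠ z → s ∉ B.Pu.support ∧ s ∉ B.Pl.support

/-- The two walks intersect exactly in a common (possibly reversed) subpath. -/
def CommonMid {y z y' z' : V} (p : G.Walk y z) (q : G.Walk y' z') : Prop :=
  ∃ (c d : V) (m : G.Walk c d), m.IsPath ∧
    m.darts <:+: p.darts ∧ (m.darts <:+: q.darts ∨ m.reverse.darts <:+: q.darts) ∧
    ∀ s, s ∈ p.support → s ∈ q.support → s ∈ m.support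

/-- `q` contains no node of `L_u` or `R_u`. -/
def AvoidsUpperOuter (B : PBC G u v w x) {y z : V} (q : G.Walk y z) : Prop :=
  ∀ s ∈ q.support, s ∉ B.Lu.support ∧ s ∉ B.Ru.support

/-- In BC3/BC4, `q₁` avoids `R_ℓ` and the start node of `q₂`, and its initial
segment `α₁` (up to the last node contained in `L_ℓ`) runs inside the cycle
`C₂` along `L_ℓ`. -/
def LlTraverse (B : PBC G u v w x) : Prop :=
  (∀ s ∈ B.q1.support, s ∉ B.Rl.support) ∧
  B.a2 ∉ B.q1.support ∧
  ∃ (y : V) (α : G.Walk B.a1 y) (β : G.Walk y B.b1),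
    B.q1 = α.append β ∧ y ∈ B.Ll.support ∧
    (∀ e ∈ α.edges, e ∈ B.S2.edges) ∧
    (∀ s ∈ β.support, s ∈ B.Ll.support → s = y)

/-- Types BC1a (`q₁` small) and BC1b (`q₁` big): `q₁,q₂,q₃` pairwise
node-disjoint and internally node-disjoint from `P_u ∪ P_ℓ`. -/
def BC1 (B : PBC G u v w x) : Prop :=
  NodeDisj B.q1 B.q2 ∧ NodeDisj B.q1 B.q3 ∧ NodeDisj B.q2 B.q3 ∧
  B.InternDisj B.q1 ∧ B.InternDisj B.q2 ∧ B.InternDisj B.q3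

/-- Types BC2a–d: `q₃` node-disjoint with `q₁` and `q₂`; `q₁` and `q₂` overlap
exactly in a common subpath (`α₂ = β₂`); everything internally node-disjoint
from `P_u ∪ P_ℓ` (the subtypes corresponding to `q₁` small/big and the two
orientations of the common subpath are subsumed). -/
def BC2 (B : PBC G u v w x) : Prop :=
  NodeDisj B.q3 B.q1 ∧ NodeDisj B.q3 B.q2 ∧
  ¬ NodeDisj B.q1 B.q2 ∧ CommonMid B.q1 B.q2 ∧
  B.InternDisj B.q1 ∧ B.InternDisj B.q2 ∧ B.InternDisj B.q3

/-- Type BC3. -/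
def BC3 (B : PBC G u v w x) : Prop :=
  B.Small ∧ (∀ e ∈ B.M.edges, e ∈ B.S1.edges) ∧
  NodeDisj B.q1 B.q2 ∧ NodeDisj B.q1 B.q3 ∧ NodeDisj B.q2 B.q3 ∧
  B.AvoidsUpperOuter B.q2 ∧ B.AvoidsUpperOuter B.q3 ∧
  B.LlTraverse

/-- Types BC4a/b. -/
def BC4 (B : PBC G u v w x) : Prop :=
  B.Small ∧ (∀ e ∈ B.M.edges, e ∈ B.S1.edges) ∧
  NodeDisj B.q3 B.q1 ∧ NodeDisj B.q3 B.q2 ∧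
  ¬ NodeDisj B.q1 B.q2 ∧ CommonMid B.q1 B.q2 ∧
  B.AvoidsUpperOuter B.q2 ∧ B.AvoidsUpperOuter B.q3 ∧
  B.LlTraverse

/-- A PBC is a bad configuration if it is of one of the nine types
BC1a, BC1b, BC2a, BC2b, BC2c, BC2d, BC3, BC4a, BC4b. -/
def IsBC (B : PBC G u v w x) : Prop := B.BC1 ∨ B.BC2 ∨ B.BC3 ∨ B.BC4

end PBC

/-- `(G,(s₁,t₁),(s₂,t₂))` contains a subgraph which is a bad configuration,
for some assignment of the terminal pairs to `(u,v)` and `(w,x)`. -/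
def ContainsBC (G : SimpleGraph V) (s₁ t₁ s₂ t₂ : V) : Prop :=
  (∃ B : PBC G s₁ t₁ s₂ t₂, B.IsBC) ∨ (∃ B : PBC G s₁ t₁ t₂ s₂, B.IsBC) ∨
  (∃ B : PBC G t₁ s₁ s₂ t₂, B.IsBC) ∨ (∃ B : PBC G t₁ s₁ t₂ s₂, B.IsBC) ∨
  (∃ B : PBC G s₂ t₂ s₁ t₁, B.IsBC) ∨ (∃ B : PBC G s₂ t₂ t₁ s₁, B.IsBC) ∨
  (∃ B : PBC G t₂ s₂ s₁ t₁, B.IsBC) ∨ (∃ B : PBC G t₂ s₂ t₁ s₁, B.IsBC)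


end NDG

set_option autoImplicit false
set_option linter.all false

section Part1
namespace NDG
open SimpleGraph
variable {V : Type*} [DecidableEq V] {G : SimpleGraph V}

/-- cost of a list of edges -/
def lc (c : Sym2 V → ℝ) (E : List (Sym2 V)) : ℝ := (E.map c).sum
/-- cost of a walk -/
def wc (c : Sym2 V → ℝ) {u v : V} (p : G.Walk u v) : ℝ := lc c p.edges

theorem lc_append (c : Sym2 V → ℝ) (A B : List (Sym2 V)) : lc c (A ++ B) = lc c A + lc c B := by
  simp [lc]

theorem lc_edges (c : Sym2 V → ℝ) {u v : V} (p : G.Walk u v) : lc c p.edges = wc c p := rfl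

theorem wc_append (c : Sym2 V → ℝ) {u v w : V} (p : G.Walk u v) (q : G.Walk v w) :
    wc c (p.append q) = wc c p + wc c q := by
  simp [wc, lc]

theorem wc_reverse (c : Sym2 V → ℝ) {u v : V} (p : G.Walk u v) :
    wc c p.reverse = wc c p := by
  simp [wc, lc, List.sum_reverse]

theorem wc_nil (c : Sym2 V → ℝ) {u : V} : wc c (Walk.nil : G.Walk u u) = 0 := by
  simp [wc, lc]

theorem wc_cons (c : Sym2 V → ℝ) {u v w : V} (h : G.Adj u v) (p : G.Walk v w) :
    wc c (Walk.cons h p) = c s(u,v) + wc c p := by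
  simp [wc, lc]

theorem lc_nonneg {c : Sym2 V → ℝ} (hc : ∀ e, 0 ≤ c e) (E : List (Sym2 V)) : 0 ≤ lc c E := by
  apply List.sum_nonneg
  simp only [List.mem_map]
  rintro x ⟨e, _, rfl⟩
  exact hc e

theorem wc_nonneg {c : Sym2 V → ℝ} (hc : ∀ e, 0 ≤ c e) {u v : V} (p : G.Walk u v) :
    0 ≤ wc c p := lc_nonneg hc _

theorem split {u v x : V} {p : G.Walk u v} (h : x ∈ p.support) :
    ∃ (q : G.Walk u x) (r : G.Walk x v), p = q.append r :=
  Walk.mem_support_iff_exists_append.mp h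

theorem first_hit (S : V → Prop) {u v : V} (p : G.Walk u v) (h : ∃ x ∈ p.support, S x) :
    ∃ (x : V) (q : G.Walk u x) (r : G.Walk x v), p = q.append r ∧ S x ∧
      ∀ z ∈ q.support, S z → z = x := by
  classical
  induction p with
  | nil =>
    obtain ⟨x, hx, hS⟩ := h
    simp at hx; subst hx
    exact ⟨_, Walk.nil, Walk.nil, rfl, hS, by simp⟩
  | @cons a b d hadj p ih =>
    by_cases ha : S a
    · exact ⟨a, Walk.nil, Walk.cons hadj p, rfl, ha, by simp⟩
    · obtain ⟨x, hx, hS⟩ := h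
      simp at hx
      have : x ∈ p.support := by
        rcases hx with rfl | hx
        · exact absurd hS ha
        · exact hx
      obtain ⟨z, q, r, hq, hz, hh⟩ := ih ⟨x, this, hS⟩
      refine ⟨z, Walk.cons hadj q, r, by rw [hq]; rfl, hz, ?_⟩
      intro y hy hSy
      simp at hy
      rcases hy with rfl | hy
      · exact absurd hSy ha
      · exact hh y hy hSy

theorem last_hit (S : V → Prop) {u v : V} (p : G.Walk u v) (h : ∃ x ∈ p.support, S x) :
    ∃ (x : V) (q : G.Walk u x) (r : G.Walk x v), p = q.append r ∧ S x ∧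
      ∀ z ∈ r.support, S z → z = x := by
  obtain ⟨x, q, r, hq, hx, hh⟩ := first_hit S p.reverse (by simpa using h)
  refine ⟨x, r.reverse, q.reverse, ?_, hx, by simpa using hh⟩
  rw [← Walk.reverse_append, ← hq, Walk.reverse_reverse]

theorem two_splits {u v x y : V} {p : G.Walk u v} {K1 : G.Walk u x} {K2 : G.Walk x v}
    {J1 : G.Walk u y} {J2 : G.Walk y v} (hK : p = K1.append K2) (hJ : p = J1.append J2) :
    (∃ X : G.Walk x y, J1 = K1.append X ∧ K2 = X.append J2) ∨
    (∃ X : G.Walk y x, K1 = J1.append X ∧ J2 = X.append K2) := by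
  induction K1 with
  | nil => 
    left
    exact ⟨J1, rfl, by rw [← hJ, hK]; rfl⟩
  | @cons a b d hadj K ih =>
    cases J1 with
    | nil => right; exact ⟨Walk.cons hadj K, rfl, by rw [← hK, hJ]; rfl⟩
    | @cons _ b' _ hadj' J =>
      cases hK
      simp only [Walk.cons_append, Walk.cons.injEq] at hJ
      obtain ⟨rfl, h⟩ := hJ
      have h := eq_of_heq h
      rcases ih rfl h with ⟨X, h1, h2⟩ | ⟨X, h1, h2⟩
      · left; exact ⟨X, by rw [h1]; rfl, h2⟩
      · right; exact ⟨X, by rw [h1]; rfl, h2⟩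

theorem path_append {u v w : V} {p : G.Walk u v} {q : G.Walk v w} :
    (p.append q).IsPath ↔ p.IsPath ∧ q.IsPath ∧
      ∀ x, x ∈ p.support → x ∈ q.support → x = v := by
  rw [Walk.isPath_def, Walk.isPath_def, Walk.isPath_def, Walk.support_append, List.nodup_append]
  have hq : q.support = v :: q.support.tail := by cases q <;> simp
  constructor
  · rintro ⟨h1, h2, h3⟩
    refine ⟨h1, ?_, ?_⟩
    · rw [hq, List.nodup_cons]
      exact ⟨fun h => h3 v (by simp) v h rfl, h2⟩
    · intro x hx hx'
      rw [hq, List.mem_cons] at hx'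
      rcases hx' with h | h
      · exact h
      · exact absurd rfl (h3 x hx x h)
  · rintro ⟨h1, h2, h3⟩
    rw [hq, List.nodup_cons] at h2
    refine ⟨h1, h2.2, ?_⟩
    intro x hx y hy hxy
    subst hxy
    have := h3 x hx (by rw [hq]; exact List.mem_cons_of_mem _ hy)
    subst this
    exact h2.1 hy

theorem msa {u v w x : V} {p : G.Walk u v} {q : G.Walk v w} :
    x ∈ (p.append q).support ↔ x ∈ p.support ∨ x ∈ q.support := by
  exact Walk.mem_support_append_iff ..

theorem msr {u v x : V} {p : G.Walk u v} : x ∈ p.reverse.support ↔ x ∈ p.support := by simp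

theorem mea {u v w : V} {e : Sym2 V} {p : G.Walk u v} {q : G.Walk v w} :
    e ∈ (p.append q).edges ↔ e ∈ p.edges ∨ e ∈ q.edges := by simp

theorem mer {u v : V} {e : Sym2 V} {p : G.Walk u v} : e ∈ p.reverse.edges ↔ e ∈ p.edges := by simp

theorem edges_disj {u v w : V} {p : G.Walk u v} {q : G.Walk v w} (h : (p.append q).IsPath)
    {e : Sym2 V} (h1 : e ∈ p.edges) : e ∉ q.edges := by
  have := h.isTrail.edges_nodup
  rw [Walk.edges_append, List.nodup_append] at this
  intro h2
  exact this.2.2 e h1 e h2 rfl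

theorem edges_ne_nil {u v : V} (p : G.Walk u v) (h : u ≠ v) : p.edges ≠ [] := by
  cases p with
  | nil => exact absurd rfl h
  | cons h p => simp

theorem exists_edge {u v : V} (p : G.Walk u v) (h : u ≠ v) : ∃ e, e ∈ p.edges :=
  List.exists_mem_of_ne_nil _ (edges_ne_nil p h)

theorem supp_of_edges {u v x y z : V} {p : G.Walk u v} {q : G.Walk x y} (h : p.edges ⊆ q.edges)
    (huv : u ≠ v) (hz : z ∈ p.support) : z ∈ q.support := by
  have : ∃ e ∈ p.edges, z ∈ e := by
    rcases Walk.mem_support_iff_exists_mem_edges.mp hz with h1 | h1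
    · have hz' : z ∈ p.reverse.support := by simpa using hz
      rcases Walk.mem_support_iff_exists_mem_edges.mp hz' with h2 | h2
      · exact absurd (h2.symm.trans h1) huv
      · simpa using h2
    · exact h1
  obtain ⟨e, he, hze⟩ := this
  induction e using Sym2.ind with
  | _ a b =>
    have := h he
    simp at hze
    rcases hze with rfl | rfl
    · exact Walk.fst_mem_support_of_mem_edges _ this
    · exact Walk.snd_mem_support_of_mem_edges _ this

theorem lc_sub_nodup {c : Sym2 V → ℝ} (hc : ∀ e, 0 ≤ c e) {A B : List (Sym2 V)}
    (hA : A.Nodup) (h : A ⊆ B) : lc c A ≤ lc c B := by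
  unfold lc
  have := List.subperm_of_subset hA h
  obtain ⟨l, hl, hs⟩ := this
  have e1 : (A.map c).sum = (l.map c).sum := ((hl.map c).sum_eq).symm
  rw [e1]
  exact (hs.map c).sum_le_sum (by simp only [List.mem_map]; rintro _ ⟨e, _, rfl⟩; exact hc e)

theorem wc_bypass_le {c : Sym2 V → ℝ} (hc : ∀ e, 0 ≤ c e) {u v : V} (p : G.Walk u v) :
    wc c p.bypass ≤ wc c p := 
  lc_sub_nodup hc (p.bypass_isPath.isTrail.edges_nodup) (p.edges_bypass_subset_edges)

end NDG
end Part1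

section Part2
namespace NDG
open SimpleGraph
variable {V : Type*} [DecidableEq V] {G : SimpleGraph V}

theorem not_reach_of_isolated {H : SimpleGraph V} {u w : V} (huw : u ≠ w)
    (hw : ∀ x, ¬ H.Adj w x) : ¬ H.Reachable u w := by
  intro h
  obtain ⟨p⟩ := h.symm
  cases p with
  | nil => exact huw rfl
  | cons h p => exact hw _ h

theorem addPath {u v : V} (p : G.Walk u v) (hp : p.IsPath) (S : Set (Sym2 V))
    (hS : (fromEdgeSet S).IsAcyclic)
    (hd : ∀ x ∈ p.support, x ≠ u → ∀ y, s(x,y) ∉ S) :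
    (fromEdgeSet (S ∪ {e | e ∈ p.edges})).IsAcyclic := by
  induction p generalizing S with
  | nil => simpa using hS
  | @cons a b d hadj p ih =>
    rw [Walk.cons_isPath_iff] at hp
    have h1 : (fromEdgeSet (S ∪ {s(a,b)})).IsAcyclic := by
      rw [fromEdgeSet_union]
      have hb : ¬ (fromEdgeSet S).Reachable a b := by
        apply not_reach_of_isolated hadj.ne
        intro x hx
        rw [fromEdgeSet_adj] at hx
        exact hd b (by simp) hadj.ne' x hx.1
      exact (hS.sup_edge_of_not_reachable hb)
    have := ih hp.1 (S ∪ {s(a,b)}) h1 (by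
      intro x hx hxb y hy
      rcases hy with hy | hy
      · refine hd x (by simp [hx]) ?_ y hy
        rintro rfl; exact hp.2 hx
      · simp only [Set.mem_singleton_iff, Sym2.eq_iff] at hy
        rcases hy with ⟨rfl, rfl⟩ | ⟨rfl, rfl⟩
        · exact hp.2 hx
        · exact hxb rfl)
    convert this using 2
    ext e
    simp only [Set.mem_union, Walk.edges_cons, List.mem_cons, Set.mem_ofPred_eq,
      Set.mem_singleton_iff]
    tauto

theorem path_acyclic {u v : V} (p : G.Walk u v) (hp : p.IsPath) :
    (fromEdgeSet {e | e ∈ p.edges}).IsAcyclic := by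
  have := addPath p hp ∅ (by simp) (by simp)
  simpa using this

theorem unique_in_acyclic {S : Set (Sym2 V)} (hS : (fromEdgeSet S).IsAcyclic) {u v : V}
    {p q : G.Walk u v} (hp : p.IsPath) (hq : q.IsPath)
    (hpS : ∀ e ∈ p.edges, e ∈ S) (hqS : ∀ e ∈ q.edges, e ∈ S) : p = q := by
  have aux : ∀ {x y : V} (r : G.Walk x y), (∀ e ∈ r.edges, e ∈ S) →
      ∀ e ∈ r.edges, e ∈ (fromEdgeSet S).edgeSet := by
    intro x y r hr e he
    rw [edgeSet_fromEdgeSet]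
    refine ⟨hr e he, ?_⟩
    exact G.not_isDiag_of_mem_edgeSet (Walk.edges_subset_edgeSet _ he)
  have h := (hS.subsingleton_path u v).elim ⟨p.transfer _ (aux p hpS), hp.transfer _⟩
    ⟨q.transfer _ (aux q hqS), hq.transfer _⟩
  have h2 := congrArg (fun (r : (fromEdgeSet S).Path u v) => r.1.support) h
  simp only [Walk.support_transfer] at h2
  exact Walk.ext_support h2

theorem unique_in_path {u v x y : V} {r : G.Walk x y} (hr : r.IsPath)
    {p q : G.Walk u v} (hp : p.IsPath) (hq : q.IsPath)
    (hpS : p.edges ⊆ r.edges) (hqS : q.edges ⊆ r.edges) : p = q :=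
  unique_in_acyclic (path_acyclic r hr) hp hq (fun e he => hpS he) (fun e he => hqS he)

/-- exchange lemma -/
theorem exch_card {x y p p' x' y' : V} {A : G.Walk x p} {σ : G.Walk p p'} {B : G.Walk p' y}
    (hW : ((A.append σ).append B).IsPath) {τ : G.Walk p p'} (hτ : τ.IsPath)
    {R : G.Walk x' y'} (hR : R.IsPath) (hτR : τ.edges ⊆ R.edges)
    {Z : Finset (Sym2 V)} (hZ : ∀ e ∈ σ.edges, e ∉ Z) :
    σ = τ ∨ (((A.append τ).append B).edges.toFinset ∪ R.edges.toFinset ∪ Z).card <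
      (((A.append σ).append B).edges.toFinset ∪ R.edges.toFinset ∪ Z).card := by
  by_cases h : σ.edges ⊆ R.edges
  · left
    have hσ : σ.IsPath := (path_append.mp (path_append.mp hW).1).2.1
    exact unique_in_path hR hσ hτ h hτR
  · right
    apply Finset.card_lt_card
    rw [Finset.ssubset_iff_of_subset]
    · obtain ⟨e, he, heR⟩ : ∃ e ∈ σ.edges, e ∉ R.edges := by
        by_contra hcon
        push Not at hcon
        exact h hcon
      refine ⟨e, by simp [he], ?_⟩
      have h1 : e ∉ B.edges := edges_disj hW (by simp [he])
      have h2 : e ∉ A.edges := fun h => edges_disj (path_append.mp hW).1 h he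
      have h3 : e ∉ τ.edges := fun h => heR (hτR h)
      simp [h1, h2, h3, heR, hZ e he]
    · intro e
      simp only [Finset.mem_union, List.mem_toFinset, mea]
      rintro ((((h|h)|h)|h)|h)
      · tauto
      · have := hτR h; tauto
      all_goals tauto
end NDG
end Part2

section Part3
namespace NDG
open SimpleGraph
variable {V : Type*} [DecidableEq V] {G : SimpleGraph V}

/-- two paths meeting in a common segment -/
structure Shape (G : SimpleGraph V) (s t s' t' : V) where
  a : V
  b : V
  L : G.Walk s a
  M : G.Walk a b
  R : G.Walk b t
  L' : G.Walk s' a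
  R' : G.Walk b t'
  hA : ((L.append M).append R).IsPath
  hB : ((L'.append M).append R').IsPath
  hab : a ≠ b
  dLL : ∀ x, x ∈ L.support → x ∈ L'.support → x = a
  dRR : ∀ x, x ∈ R.support → x ∈ R'.support → x = b
  dLR : ∀ x, x ∈ L.support → x ∉ R'.support
  dRL : ∀ x, x ∈ R.support → x ∉ L'.support

namespace Shape
variable {s t s' t' : V} (I : Shape G s t s' t')

@[reducible] def mirror : Shape G t s t' s' where
  a := I.b
  b := I.a
  L := I.R.reverse
  M := I.M.reverse
  R := I.L.reverse
  L' := I.R'.reverse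
  R' := I.L'.reverse
  hA := by
    rw [← Walk.reverse_append, ← Walk.reverse_append, Walk.isPath_reverse_iff, Walk.append_assoc]
    exact I.hA
  hB := by
    rw [← Walk.reverse_append, ← Walk.reverse_append, Walk.isPath_reverse_iff, Walk.append_assoc]
    exact I.hB
  hab := I.hab.symm
  dLL := by simpa using I.dRR
  dRR := by simpa using I.dLL
  dLR := by simpa using I.dRL
  dRL := by simpa using I.dLR

@[reducible] def swap : Shape G s' t' s t where
  a := I.a
  b := I.b
  L := I.L'
  M := I.M
  R := I.R'
  L' := I.L
  R' := I.R
  hA := I.hB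
  hB := I.hA
  hab := I.hab
  dLL := fun x h1 h2 => I.dLL x h2 h1
  dRR := fun x h1 h2 => I.dRR x h2 h1
  dLR := fun x h1 h2 => I.dRL x h2 h1
  dRL := fun x h1 h2 => I.dLR x h2 h1

theorem pM : I.M.IsPath := (path_append.mp (path_append.mp I.hA).1).2.1
theorem pL : I.L.IsPath := (path_append.mp (path_append.mp I.hA).1).1
theorem pR : I.R.IsPath := (path_append.mp I.hA).2.1
theorem pL' : I.L'.IsPath := (path_append.mp (path_append.mp I.hB).1).1
theorem pR' : I.R'.IsPath := (path_append.mp I.hB).2.1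
theorem LM : ∀ x, x ∈ I.L.support → x ∈ I.M.support → x = I.a :=
  (path_append.mp (path_append.mp I.hA).1).2.2
theorem LM' : ∀ x, x ∈ I.L'.support → x ∈ I.M.support → x = I.a :=
  (path_append.mp (path_append.mp I.hB).1).2.2
theorem MR : ∀ x, x ∈ I.M.support → x ∈ I.R.support → x = I.b :=
  fun x h1 h2 => (path_append.mp I.hA).2.2 x (by simp [h1]) h2
theorem MR' : ∀ x, x ∈ I.M.support → x ∈ I.R'.support → x = I.b :=
  fun x h1 h2 => (path_append.mp I.hB).2.2 x (by simp [h1]) h2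
theorem LR : ∀ x, x ∈ I.L.support → x ∉ I.R.support := by
  intro x h1 h2
  have := (path_append.mp I.hA).2.2 x (by simp [h1]) h2
  subst this
  exact I.hab (I.LM _ h1 (by simp)).symm
theorem LR' : ∀ x, x ∈ I.L'.support → x ∉ I.R'.support := by
  intro x h1 h2
  have := (path_append.mp I.hB).2.2 x (by simp [h1]) h2
  subst this
  exact I.hab (I.LM' _ h1 (by simp)).symm

theorem forest : (fromEdgeSet {e | e ∈ ((I.L.append I.M).append I.R).edges ∨
    e ∈ ((I.L'.append I.M).append I.R').edges}).IsAcyclic := by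
  have h1 := path_acyclic _ I.hA
  have supp : ∀ x y, s(x,y) ∈ ((I.L.append I.M).append I.R).edges →
      x ∈ I.L.support ∨ x ∈ I.M.support ∨ x ∈ I.R.support := by
    intro x y h
    have := Walk.fst_mem_support_of_mem_edges _ h
    simp only [msa] at this
    tauto
  have supp' : ∀ x y, s(x,y) ∈ I.L'.edges → x ∈ I.L'.support := by
    intro x y h
    exact Walk.fst_mem_support_of_mem_edges _ h
  have h2 := addPath I.L'.reverse (by simpa using I.pL') _ h1 (by
    intro x hx hxa y hy
    rw [msr] at hx
    rcases supp x y hy with h | h | h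
    · exact hxa (I.dLL x h hx)
    · exact hxa (I.LM' x hx h)
    · exact I.dRL x h hx)
  have h3 := addPath I.R' I.pR' _ h2 (by
    intro x hx hxa y hy
    rcases hy with hy | hy
    · rcases supp x y hy with h | h | h
      · exact I.dLR x h hx
      · exact hxa (I.MR' x h hx)
      · exact hxa (I.dRR x h hx)
    · simp only [Set.mem_ofPred_eq, mer] at hy
      exact I.LR' x (supp' x y hy) hx)
  convert h3 using 2
  ext e
  simp only [Set.mem_union, Set.mem_ofPred_eq, mea, mer]
  tauto

theorem emeet : ∀ e, e ∈ ((I.L.append I.M).append I.R).edges →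
      e ∈ ((I.L'.append I.M).append I.R').edges → e ∈ I.M.edges := by
  intro e
  induction e using Sym2.ind with
  | _ x y =>
    intro h1 h2
    by_contra hM
    have e0 : ∀ {u v : V} (p : G.Walk u v), s(x,y) ∈ p.edges → x ∈ p.support ∧ y ∈ p.support :=
      fun p h => ⟨Walk.fst_mem_support_of_mem_edges _ h, Walk.snd_mem_support_of_mem_edges _ h⟩
    have hxy : x ≠ y := (Walk.adj_of_mem_edges _ h1).ne
    simp only [mea, hM, or_false] at h1 h2
    have a1 := I.dLL; have a2 := I.dRR; have a3 := I.dLR; have a4 := I.dRL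
    rcases h1 with h1 | h1 <;> rcases h2 with h2 | h2
    · exact hxy ((a1 x (e0 _ h1).1 (e0 _ h2).1).trans (a1 y (e0 _ h1).2 (e0 _ h2).2).symm)
    · exact a3 x (e0 _ h1).1 (e0 _ h2).1
    · exact a4 x (e0 _ h1).1 (e0 _ h2).1
    · exact hxy ((a2 x (e0 _ h1).1 (e0 _ h2).1).trans (a2 y (e0 _ h1).2 (e0 _ h2).2).symm)

end Shape

/-- an optimal two-player instance without bad configuration -/
structure Inst (c : Sym2 V → ℝ) (G : SimpleGraph V) (s t s' t' : V) extends Shape G s t s' t' where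
  c0 : ∀ e, 0 ≤ c e
  opt : ∀ (P : G.Walk s t) (Q : G.Walk s' t') (E : List (Sym2 V)), P.edges ⊆ E → Q.edges ⊆ E →
    wc c L + wc c M + wc c R + wc c L' + wc c R' ≤ lc c E
  nobc : ¬ ContainsBC G s t s' t'

theorem closed_nil {x : V} {X : G.Walk x x} (h : X.IsPath) : X = Walk.nil :=
  Walk.eq_nil_iff_nil.mpr (Walk.isPath_iff_nil.mp h)

namespace Inst
variable {c : Sym2 V → ℝ} {s t s' t' : V} 

@[reducible] def mirror (I : Inst c G s t s' t') : Inst c G t s t' s' where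
  toShape := I.toShape.mirror
  c0 := I.c0
  opt := by
    intro P Q E hP hQ
    have := I.opt P.reverse Q.reverse E (by simpa using hP) (by simpa using hQ)
    simp only [Shape.mirror, wc_reverse]
    linarith
  nobc := by
    have := I.nobc
    unfold ContainsBC at *
    tauto

@[reducible] def swap (I : Inst c G s t s' t') : Inst c G s' t' s t where
  toShape := I.toShape.swap
  c0 := I.c0
  opt := by
    intro P Q E hP hQ
    have := I.opt Q P E hQ hP
    simp only [Shape.swap]
    linarith
  nobc := by
    have := I.nobc
    unfold ContainsBC at *
    tauto

variable (I : Inst c G s t s' t')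
@[simp] theorem mirror_a : I.mirror.a = I.b := rfl
@[simp] theorem mirror_b : I.mirror.b = I.a := rfl
@[simp] theorem mirror_L : I.mirror.L = I.R.reverse := rfl
@[simp] theorem mirror_M : I.mirror.M = I.M.reverse := rfl
@[simp] theorem mirror_R : I.mirror.R = I.L.reverse := rfl
@[simp] theorem mirror_L' : I.mirror.L' = I.R'.reverse := rfl
@[simp] theorem mirror_R' : I.mirror.R' = I.L'.reverse := rfl
@[simp] theorem swap_a : I.swap.a = I.a := rfl
@[simp] theorem swap_b : I.swap.b = I.b := rfl
@[simp] theorem swap_L : I.swap.L = I.L' := rfl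
@[simp] theorem swap_M : I.swap.M = I.M := rfl
@[simp] theorem swap_R : I.swap.R = I.R' := rfl
@[simp] theorem swap_L' : I.swap.L' = I.L := rfl
@[simp] theorem swap_R' : I.swap.R' = I.R := rfl

/-- position along M -/
noncomputable def C (p : V) : ℝ :=
  if h : p ∈ I.M.support then wc c (I.M.takeUntil p h) else 0

noncomputable def Cm : ℝ := wc c I.M

noncomputable def cF : ℝ := wc c I.L + wc c I.M + wc c I.R + wc c I.L' + wc c I.R'

theorem opt' (P : G.Walk s t) (Q : G.Walk s' t') (E : List (Sym2 V)) (h1 : P.edges ⊆ E)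
    (h2 : Q.edges ⊆ E) : wc c I.L + I.Cm + wc c I.R + wc c I.L' + wc c I.R' ≤ lc c E :=
  I.opt P Q E h1 h2

theorem C_eq {p : V} {K1 : G.Walk I.a p} {K2 : G.Walk p I.b} (h : I.M = K1.append K2) :
    I.C p = wc c K1 := by
  have hp : p ∈ I.M.support := by rw [h]; simp
  have h2 := (I.M.take_spec hp).symm
  have hM := I.pM
  unfold C
  rw [dif_pos hp]
  rcases two_splits h h2 with ⟨X, e1, e2⟩ | ⟨X, e1, e2⟩
  · rw [h, e2] at hM
    have := closed_nil (path_append.mp (path_append.mp hM).2.1).1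
    rw [e1, this]; simp
  · rw [h2, e2] at hM
    have := closed_nil (path_append.mp (path_append.mp hM).2.1).1
    rw [e1, this]; simp

theorem C_eq2 {p : V} {K1 : G.Walk I.a p} {K2 : G.Walk p I.b} (h : I.M = K1.append K2) :
    wc c K2 = I.Cm - I.C p := by
  rw [I.C_eq h, Cm, h, wc_append]; ring

theorem C_a : I.C I.a = 0 := by
  rw [I.C_eq (K1 := Walk.nil) (K2 := I.M) rfl, wc_nil]

theorem C_b : I.C I.b = I.Cm := by
  rw [I.C_eq (K1 := I.M) (K2 := Walk.nil) (by simp)]; rfl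

theorem C_nonneg (p : V) : 0 ≤ I.C p := by
  unfold C
  split_ifs
  · exact wc_nonneg I.c0 _
  · exact le_rfl

theorem C_le {p : V} (h : p ∈ I.M.support) : I.C p ≤ I.Cm := by
  obtain ⟨K1, K2, h⟩ := split h
  have := I.C_eq2 h
  have := wc_nonneg I.c0 K2
  linarith

theorem mirror_Cm : I.mirror.Cm = I.Cm := by
  simp [Cm, wc_reverse]

theorem mirror_C {p : V} (h : p ∈ I.M.support) : I.mirror.C p = I.Cm - I.C p := by
  obtain ⟨K1, K2, h⟩ := split h
  rw [I.mirror.C_eq (K1 := K2.reverse) (K2 := K1.reverse) (by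
    rw [mirror_M, h, Walk.reverse_append]), wc_reverse, I.C_eq2 h]

@[simp] theorem swap_Cm : I.swap.Cm = I.Cm := rfl
@[simp] theorem swap_C (p : V) : I.swap.C p = I.C p := rfl

theorem pre {p : V} (h : p ∈ I.M.support) : ∃ (K1 : G.Walk I.a p) (K2 : G.Walk p I.b),
    I.M = K1.append K2 ∧ wc c K1 = I.C p ∧ wc c K2 = I.Cm - I.C p ∧
    (∀ e ∈ K1.edges, e ∈ I.M.edges) ∧ (∀ e ∈ K2.edges, e ∈ I.M.edges) := by
  obtain ⟨K1, K2, h⟩ := split h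
  exact ⟨K1, K2, h, (I.C_eq h).symm, I.C_eq2 h, by rw [h]; simp; tauto, by rw [h]; simp; tauto⟩

/-- ordered splitting of M at two points -/
theorem ordered {p q : V} (hp : p ∈ I.M.support) (hq : q ∈ I.M.support) :
    (∃ (K1 : G.Walk I.a p) (X : G.Walk p q) (K2 : G.Walk q I.b),
      I.M = (K1.append X).append K2) ∨
    (∃ (K1 : G.Walk I.a q) (X : G.Walk q p) (K2 : G.Walk p I.b),
      I.M = (K1.append X).append K2) := by
  obtain ⟨K1, K2, h⟩ := split hp
  obtain ⟨J1, J2, h'⟩ := split hq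
  rcases two_splits h h' with ⟨X, e1, e2⟩ | ⟨X, e1, e2⟩
  · left; exact ⟨K1, X, J2, by rw [h', e1]⟩
  · right; exact ⟨J1, X, K2, by rw [h, e1]⟩

theorem ord_C {p q : V} {K1 : G.Walk I.a p} {X : G.Walk p q} {K2 : G.Walk q I.b}
      (h : I.M = (K1.append X).append K2) : wc c K1 = I.C p ∧ wc c X = I.C q - I.C p ∧
      wc c K2 = I.Cm - I.C q ∧ I.C p ≤ I.C q := by
  have h1 := I.C_eq h
  have h2 := I.C_eq2 h
  have h3 := I.C_eq (K1 := K1) (K2 := X.append K2) (by rw [h, Walk.append_assoc])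
  rw [wc_append] at h1
  have := wc_nonneg I.c0 X
  refine ⟨h3.symm, by linarith, h2, by linarith⟩

/-- strictly ordered -/
theorem ordered_lt {p q : V} (hp : p ∈ I.M.support) (hq : q ∈ I.M.support) (h : I.C p < I.C q) :
    (∃ (K1 : G.Walk I.a p) (X : G.Walk p q) (K2 : G.Walk q I.b),
      I.M = (K1.append X).append K2) := by
  rcases I.ordered hp hq with h1 | ⟨K1, X, K2, h1⟩
  · exact h1
  · have := (I.ord_C h1).2.2.2
    linarith

theorem seg {p q : V} (hp : p ∈ I.M.support) (hq : q ∈ I.M.support) :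
    ∃ X : G.Walk p q, (∀ e ∈ X.edges, e ∈ I.M.edges) ∧ (∀ e ∈ X.support, e ∈ I.M.support) ∧
      wc c X = |I.C q - I.C p| := by
  rcases I.ordered hp hq with ⟨K1, X, K2, h⟩ | ⟨K1, X, K2, h⟩
  · refine ⟨X, ?_, ?_, ?_⟩
    · rw [h]; simp; tauto
    · rw [h]; simp only [msa]; tauto
    · have := I.ord_C h
      rw [this.2.1, abs_of_nonneg]; linarith
  · refine ⟨X.reverse, ?_, ?_, ?_⟩
    · rw [h]; simp; tauto
    · rw [h]; simp only [msa, msr]; tauto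
    · have := I.ord_C h
      rw [wc_reverse, this.2.1, abs_of_nonpos] <;> linarith

theorem heads {p q : V} (hp : p ∈ I.M.support) (hq : q ∈ I.M.support) :
    ∃ (E : List (Sym2 V)) (H1 : G.Walk I.a p) (H2 : G.Walk I.a q),
      (∀ e ∈ H1.edges, e ∈ E) ∧ (∀ e ∈ H2.edges, e ∈ E) ∧ lc c E = max (I.C p) (I.C q) ∧
      (∀ e ∈ E, e ∈ I.M.edges) := by
  rcases I.ordered hp hq with ⟨K1, X, K2, h⟩ | ⟨K1, X, K2, h⟩
  · have := I.ord_C h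
    refine ⟨(K1.append X).edges, K1, K1.append X, by simp; tauto, by simp, ?_, by rw [h]; simp; tauto⟩
    rw [lc_edges, wc_append, this.1, this.2.1, max_eq_right] <;> linarith
  · have := I.ord_C h
    refine ⟨(K1.append X).edges, K1.append X, K1, by simp, by simp; tauto, ?_, by rw [h]; simp; tauto⟩
    rw [lc_edges, wc_append, this.1, this.2.1, max_eq_left] <;> linarith

theorem tails {p q : V} (hp : p ∈ I.M.support) (hq : q ∈ I.M.support) :
    ∃ (E : List (Sym2 V)) (H1 : G.Walk p I.b) (H2 : G.Walk q I.b),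
      (∀ e ∈ H1.edges, e ∈ E) ∧ (∀ e ∈ H2.edges, e ∈ E) ∧ lc c E = I.Cm - min (I.C p) (I.C q) ∧
      (∀ e ∈ E, e ∈ I.M.edges) := by
  rcases I.ordered hp hq with ⟨K1, X, K2, h⟩ | ⟨K1, X, K2, h⟩
  · have := I.ord_C h
    refine ⟨(X.append K2).edges, X.append K2, K2, by simp, by simp; tauto, ?_, by rw [h]; simp; tauto⟩
    rw [lc_edges, wc_append, this.2.1, this.2.2.1, min_eq_left] <;> linarith
  · have := I.ord_C h
    refine ⟨(X.append K2).edges, K2, X.append K2, by simp; tauto, by simp, ?_, by rw [h]; simp; tauto⟩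
    rw [lc_edges, wc_append, this.2.1, this.2.2.1, min_eq_right] <;> linarith

end Inst
end NDG
end Part3

section Part4
namespace NDG
open SimpleGraph
variable {V : Type*} [DecidableEq V] {G : SimpleGraph V}
namespace Inst
variable {c : Sym2 V → ℝ} {s t s' t' : V} (I : Inst c G s t s' t')

theorem b_s' {k : V} (X : G.Walk s' k) (hk : k ∈ I.M.support) : wc c I.L' ≤ wc c X := by
  obtain ⟨K1, K2, h, h1, h2, h3, h4⟩ := I.pre hk
  have := I.opt' ((I.L.append I.M).append I.R) ((X.append K2).append I.R')
    (I.L.edges ++ I.M.edges ++ I.R.edges ++ X.edges ++ I.R'.edges)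
    (by intro e; simp only [mea, mer, List.mem_append]; grind)
    (by intro e; simp only [mea, mer, List.mem_append]; grind)
  simp only [lc_append, lc_edges] at this
  unfold Cm at this
  linarith

theorem b_s {k : V} (X : G.Walk s k) (hk : k ∈ I.M.support) : wc c I.L ≤ wc c X :=
  I.swap.b_s' X hk

theorem b_t {k : V} (X : G.Walk k t) (hk : k ∈ I.M.support) : wc c I.R ≤ wc c X := by
  have := I.mirror.b_s X.reverse (by simpa using hk)
  simpa [wc_reverse] using this

theorem b_t' {k : V} (X : G.Walk k t') (hk : k ∈ I.M.support) : wc c I.R' ≤ wc c X :=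
  I.swap.b_t X hk

theorem b_M {p q : V} (X : G.Walk p q) (hp : p ∈ I.M.support) (hq : q ∈ I.M.support) :
    |I.C q - I.C p| ≤ wc c X := by
  have key : ∀ {p q : V} (X : G.Walk p q), (∃ (K1 : G.Walk I.a p) (X : G.Walk p q) (K2 : G.Walk q I.b),
      I.M = (K1.append X).append K2) → |I.C q - I.C p| ≤ wc c X := by
    rintro p q X ⟨K1, Y, K2, h⟩
    have h1 := I.ord_C h
    have := I.opt' ((((I.L.append K1).append X).append K2).append I.R)
      ((((I.L'.append K1).append X).append K2).append I.R')
      (I.L.edges ++ K1.edges ++ X.edges ++ K2.edges ++ I.R.edges ++ I.L'.edges ++ I.R'.edges)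
      (by intro e; simp only [mea, mer, List.mem_append]; grind)
      (by intro e; simp only [mea, mer, List.mem_append]; grind)
    simp only [lc_append, lc_edges] at this
    rw [abs_of_nonneg (by linarith)]
    linarith
  rcases I.ordered hp hq with h | h
  · exact key X h
  · have := key X.reverse h
    rw [wc_reverse, abs_sub_comm] at this
    exact this

theorem b_M' {p q : V} (X : G.Walk p q) (hp : p ∈ I.M.support) (hq : q ∈ I.M.support) :
    I.C q - I.C p ≤ wc c X ∧ I.C p - I.C q ≤ wc c X := by
  have := abs_le.mp (I.b_M X hp hq)
  constructor <;> linarith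

theorem o1 {j k : V} (U : G.Walk s j) (X : G.Walk s' k) (hj : j ∈ I.M.support)
    (hk : k ∈ I.M.support) : wc c I.L + wc c I.L' + min (I.C j) (I.C k) ≤ wc c U + wc c X := by
  obtain ⟨E, H1, H2, h1, h2, h3, h4⟩ := I.tails hj hk
  have := I.opt' ((U.append H1).append I.R) ((X.append H2).append I.R')
    (U.edges ++ X.edges ++ E ++ I.R.edges ++ I.R'.edges)
    (by intro e; simp only [mea, mer, List.mem_append]; grind)
    (by intro e; simp only [mea, mer, List.mem_append]; grind)
  simp only [lc_append, lc_edges] at this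
  linarith

theorem o2 {i l : V} (U : G.Walk i t) (X : G.Walk l t') (hi : i ∈ I.M.support)
    (hl : l ∈ I.M.support) :
    wc c I.R + wc c I.R' + I.Cm - max (I.C i) (I.C l) ≤ wc c U + wc c X := by
  obtain ⟨E, H1, H2, h1, h2, h3, h4⟩ := I.heads hi hl
  have := I.opt' ((I.L.append H1).append U) ((I.L'.append H2).append X)
    (U.edges ++ X.edges ++ E ++ I.L.edges ++ I.L'.edges)
    (by intro e; simp only [mea, mer, List.mem_append]; grind)
    (by intro e; simp only [mea, mer, List.mem_append]; grind)
  simp only [lc_append, lc_edges] at this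
  linarith

/-- two disjoint complete walks -/
theorem o3 (W : G.Walk s t) (X : G.Walk s' t') :
    wc c I.L + I.Cm + wc c I.R + wc c I.L' + wc c I.R' ≤ wc c W + wc c X := by
  have := I.opt' W X (W.edges ++ X.edges) (by simp) (by simp)
  simpa only [lc_append, lc_edges] using this

/-- upper walk from a point on M when the lower walk starts with the second left part -/
theorem memM_a : I.a ∈ I.M.support := by simp
theorem memM_b : I.b ∈ I.M.support := by simp

end Inst
end NDG
end Part4

section Part5
namespace NDG
open SimpleGraph
variable {V : Type*} [DecidableEq V] {G : SimpleGraph V}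
variable {c : Sym2 V → ℝ} {s t s' t' : V} 

/-- overlapping detour situation for the lower player -/
structure BP (I : Inst c G s t s' t') (κ : ℝ) {k l : V} (V1 : G.Walk s' k) (V2 : G.Walk l t') :
    Prop where
  hκ : ∀ X : G.Walk s' t',
    wc c I.L + I.Cm + wc c I.R + wc c I.L' + wc c I.R' ≤ κ + wc c X
  N : κ + wc c V1 + wc c V2 < wc c I.L + I.Cm + wc c I.R + wc c I.L' + wc c I.R'
  hlk : I.C l < I.C k
  kM : k ∈ I.M.support
  lM : l ∈ I.M.support

namespace BP
variable {I : Inst c G s t s' t'} {κ : ℝ} {k l : V} {V1 : G.Walk s' k} {V2 : G.Walk l t'}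

theorem mirror (h : BP I κ V1 V2) : BP I.mirror κ V2.reverse V1.reverse where
  hκ := by
    intro X
    have := h.hκ X.reverse
    simp only [I.mirror_Cm, Inst.mirror_L, Inst.mirror_R, Inst.mirror_L', Inst.mirror_R', wc_reverse] at *
    linarith
  N := by
    have := h.N
    simp only [I.mirror_Cm, Inst.mirror_L, Inst.mirror_R, Inst.mirror_L', Inst.mirror_R', wc_reverse] at *
    linarith
  hlk := by
    rw [I.mirror_C h.kM, I.mirror_C h.lM]
    have := h.hlk
    linarith
  kM := by simpa using h.lM
  lM := by simpa using h.kM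

theorem dV (h : BP I κ V1 V2) : ∀ x, x ∈ V1.support → x ∉ V2.support := by
  intro p h1 h2
  obtain ⟨A, B, rfl⟩ := split h1
  obtain ⟨A', B', rfl⟩ := split h2
  have h3 := h.hκ (A.append B')
  have h4 := h.N
  have := wc_nonneg I.c0 B
  have := wc_nonneg I.c0 A'
  simp only [wc_append] at *
  linarith

theorem small (h : BP I κ V1 V2) : wc c V1 < wc c I.L' + I.C l := by
  obtain ⟨K1, K2, e, h1, h2, h3, h4⟩ := I.pre h.lM
  have := h.hκ ((I.L'.append K1).append V2)
  have := h.N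
  simp only [wc_append] at *
  linarith

theorem V1L (h : BP I κ V1 V2) : ∀ x, x ∈ V1.support → x ∉ I.L.support := by
  intro p h1 h2
  have hs := h.small
  have := h.hlk
  obtain ⟨A, B, rfl⟩ := split h1
  obtain ⟨L1, L2, e⟩ := split h2
  obtain ⟨K1, K2, e', h1, h2, h3, h4⟩ := I.pre h.kM
  have := I.opt' (((L1.append B).append K2).append I.R) (((A.append B).append K2).append I.R')
    (L1.edges ++ A.edges ++ B.edges ++ K2.edges ++ I.R.edges ++ I.R'.edges)
    (by intro e; simp only [mea, mer, List.mem_append]; grind)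
    (by intro e; simp only [mea, mer, List.mem_append]; grind)
  have e2 : wc c I.L = wc c L1 + wc c L2 := by rw [e, wc_append]
  have := wc_nonneg I.c0 L2
  simp only [lc_append, lc_edges, wc_append] at *
  linarith

theorem V1R (h : BP I κ V1 V2) : ∀ x, x ∈ V1.support → x ∉ I.R.support := by
  intro p h1 h2
  have hN := h.N
  obtain ⟨A, B, rfl⟩ := split h1
  obtain ⟨R1, R2, e⟩ := split h2
  have e2 : wc c I.R = wc c R1 + wc c R2 := by rw [e, wc_append]
  obtain ⟨K1, K2, e', h1, h2, h3, h4⟩ := I.pre h.kM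
  have h5 := I.opt' (((I.L.append K1).append B.reverse).append R2) ((I.L'.append I.M).append I.R')
    (I.L.edges ++ I.L'.edges ++ I.M.edges ++ B.edges ++ R2.edges ++ I.R'.edges)
    (by intro e; simp only [mea, mer, List.mem_append]; grind)
    (by intro e; simp only [mea, mer, List.mem_append]; grind)
  have h6 := h.hκ ((A.append R1.reverse).append I.R')
  have h7 := I.b_t' V2 h.lM
  have : wc c I.M = I.Cm := rfl
  simp only [lc_append, lc_edges, wc_append, wc_reverse] at *
  linarith

theorem V1R' (h : BP I κ V1 V2) : ∀ x, x ∈ V1.support → x ∉ I.R'.support := by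
  intro p h1 h2
  have hN := h.N
  obtain ⟨A, B, rfl⟩ := split h1
  obtain ⟨R1, R2, e⟩ := split h2
  have e2 : wc c I.R' = wc c R1 + wc c R2 := by rw [e, wc_append]
  have h6 := h.hκ (A.append R2)
  have h7 := I.b_t' V2 h.lM
  have := wc_nonneg I.c0 B
  have := wc_nonneg I.c0 R1
  simp only [lc_append, lc_edges, wc_append, wc_reverse] at *
  linarith

theorem V2R (h : BP I κ V1 V2) : ∀ x, x ∈ V2.support → x ∉ I.R.support := by
  simpa using h.mirror.V1L
theorem V2L (h : BP I κ V1 V2) : ∀ x, x ∈ V2.support → x ∉ I.L.support := by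
  simpa using h.mirror.V1R
theorem V2L' (h : BP I κ V1 V2) : ∀ x, x ∈ V2.support → x ∉ I.L'.support := by
  simpa using h.mirror.V1R'

theorem V1M (h : BP I κ V1 V2) : ∀ x, x ∈ V1.support → x ∈ I.M.support → I.C l < I.C x := by
  intro p h1 h2
  by_contra hcon
  have hN := h.N
  have := h.hlk
  obtain ⟨A, B, rfl⟩ := split h1
  obtain ⟨X, x1, x2, x3⟩ := I.seg h2 h.lM
  have h3 := (I.b_M' B h2 h.kM).1
  have h6 := h.hκ ((A.append X).append V2)
  rw [abs_of_nonneg (by linarith)] at x3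
  simp only [lc_append, lc_edges, wc_append, wc_reverse] at *
  linarith

theorem V2M (h : BP I κ V1 V2) : ∀ x, x ∈ V2.support → x ∈ I.M.support → I.C x < I.C k := by
  intro x h1 h2
  have := h.mirror.V1M x (by simpa using h1) (by simpa using h2)
  rw [I.mirror_C h.kM, I.mirror_C h2] at this
  linarith

theorem shrink1 (h : BP I κ V1 V2) : ∃ (w k' : V) (A : G.Walk s' w) (q2 : G.Walk w k')
    (X : G.Walk k' k), V1 = (A.append q2).append X ∧ w ∈ I.L'.support ∧
    (∀ x, x ∈ q2.support → x ∈ I.L'.support → x = w) ∧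
    (∀ x, x ∈ q2.support → x ∈ I.M.support → x = k') ∧ BP I κ (A.append q2) V2 := by
  obtain ⟨w, A, B, e, hw, hB⟩ := last_hit (fun x => x ∈ I.L'.support) V1 ⟨s', by simp, by simp⟩
  obtain ⟨k', q2, X, e', hk', hq⟩ := first_hit (fun x => x ∈ I.M.support) B ⟨k, by simp, h.kM⟩
  have e2 : V1 = (A.append q2).append X := by rw [e, e', Walk.append_assoc]
  refine ⟨w, k', A, q2, X, e2, hw, ?_, hq, ?_⟩
  · intro x hx hx'
    apply hB x _ hx'
    rw [e']; simp [hx]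
  · refine ⟨h.hκ, ?_, h.V1M k' (by rw [e2]; simp) hk', hk', h.lM⟩
    have := h.N
    have := wc_nonneg I.c0 X
    rw [e2] at *
    simp only [wc_append] at *
    linarith

theorem shrink2 (h : BP I κ V1 V2) : ∃ (w' l' : V) (A : G.Walk w' t') (q3 : G.Walk l' w')
    (X : G.Walk l l'), V2 = X.append (q3.append A) ∧ w' ∈ I.R'.support ∧
    (∀ x, x ∈ q3.support → x ∈ I.R'.support → x = w') ∧
    (∀ x, x ∈ q3.support → x ∈ I.M.support → x = l') ∧ BP I κ V1 (q3.append A) := by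
  obtain ⟨w', l', A, q, X, e, h1, h2, h3, h4⟩ := h.mirror.shrink1
  refine ⟨w', l', A.reverse, q.reverse, X.reverse, ?_, by simpa using h1, by simpa using h2, by simpa using h3, ?_⟩
  · rw [← Walk.reverse_append, ← Walk.reverse_append, ← e, Walk.reverse_reverse]
  · have := h4.mirror
    rw [Walk.reverse_append, Walk.reverse_reverse] at this
    refine ⟨h.hκ, ?_, ?_, h.kM, by simpa using this.lM⟩
    · have := h4.N
      simp only [I.mirror_Cm, Inst.mirror_L, Inst.mirror_R, Inst.mirror_L', Inst.mirror_R', wc_reverse, wc_append] at *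
      linarith
    · have hl : l' ∈ I.M.support := by simpa using h4.kM
      have := h4.hlk
      rw [I.mirror_C h.kM, I.mirror_C hl] at this
      linarith

end BP
end NDG
end Part5

section Part6
namespace NDG
open SimpleGraph
variable {V : Type*} [DecidableEq V] {G : SimpleGraph V}
variable {s t s' t' : V} 

/-- raw data of a preliminary bad configuration -/
structure Raw (I : Shape G s t s' t') where
  k : V
  l : V
  w : V
  w' : V
  y : V
  r : V
  m1 : G.Walk I.a l
  m2 : G.Walk l k
  m3 : G.Walk k I.b
  hM : I.M = (m1.append m2).append m3
  hlk : l ≠ k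
  hkb : k ≠ I.b
  ρ1 : G.Walk I.b r
  ρ2 : G.Walk r t
  hR : I.R = ρ1.append ρ2
  hr : r ≠ I.b
  l1 : G.Walk s' w
  l2 : G.Walk w I.a
  hL' : I.L' = l1.append l2
  hw : w ≠ I.a
  r1 : G.Walk I.b w'
  r2 : G.Walk w' t'
  hR' : I.R' = r1.append r2
  hw' : w' ≠ I.b
  q2 : G.Walk w k
  pq2 : q2.IsPath
  cq2 : ∀ x, x ∈ q2.support → (x ∈ I.L'.support → x = w) ∧ (x ∈ I.M.support → x = k) ∧
    x ∉ I.R'.support ∧ x ∉ I.L.support ∧ x ∉ I.R.support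
  q3 : G.Walk l w'
  pq3 : q3.IsPath
  cq3 : ∀ x, x ∈ q3.support → (x ∈ I.R'.support → x = w') ∧ (x ∈ I.M.support → x = l) ∧
    x ∉ I.L'.support ∧ x ∉ I.L.support ∧ x ∉ I.R.support
  S : G.Walk y I.b
  hS : (S.append ρ1).darts <:+: ((I.L.append I.M).append I.R).darts
  m2S : m2.edges ⊆ S.edges
  m3S : m3.edges ⊆ S.edges
  m1S : ∃ e ∈ m1.edges, e ∈ S.edges
  q1 : G.Walk y r
  pq1 : q1.IsPath
  hyr : y ≠ r
  cq1 : ∀ x, x ∈ q1.support → x ∈ I.L.support ∨ x ∈ I.M.support ∨ x ∈ I.R.support →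
    x = y ∨ x = r
  d13 : ∀ x, x ∈ q1.support → x ∉ q3.support
  d23 : ∀ x, x ∈ q2.support → x ∉ q3.support
  d12 : (∀ x, x ∈ q1.support → x ∉ q2.support) ∨ PBC.CommonMid q1 q2

namespace Raw
variable {I : Shape G s t s' t'} (D : Raw I)

def pbc : PBC G s t s' t' := by
  have nd := I.hB.isTrail.edges_nodup
  have hM := D.hM
  have hL' := D.hL'
  have hR' := D.hR'
  have hM' : ∀ e, e ∈ I.M.edges ↔ e ∈ D.m1.edges ∨ e ∈ D.m2.edges ∨ e ∈ D.m3.edges := by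
    rw [hM]; simp [or_assoc]
  have g1 : ∀ e, e ∈ D.m3.edges → e ∉ ((D.l2.append D.m1).append D.m2).edges := by
    rw [hM, hL'] at nd
    simp only [Walk.edges_append] at nd ⊢
    simp only [List.nodup_append, List.mem_append] at nd ⊢
    grind
  have g2 : ∀ e, e ∈ D.m1.edges → e ∉ ((D.m2.append D.m3).append D.r1).edges := by
    rw [hM, hR'] at nd
    simp only [Walk.edges_append] at nd ⊢
    simp only [List.nodup_append, List.mem_append] at nd ⊢
    grind
  have S2 : ∀ e, e ∈ D.m1.edges ∨ e ∈ D.m2.edges ∨ e ∈ D.l2.edges ↔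
      e ∈ ((D.l2.append D.m1).append D.m2).edges := by
    intro e; simp only [mea]; tauto
  have S3 : ∀ e, e ∈ D.m2.edges ∨ e ∈ D.m3.edges ∨ e ∈ D.r1.edges ↔
      e ∈ ((D.m2.append D.m3).append D.r1).edges := by
    intro e; simp only [mea]; tauto
  have S1 : ∀ e, e ∈ D.S.edges → e ∈ (D.S.append D.ρ1).edges := by
    intro e; simp only [mea]; tauto
  have x1 := D.m1S
  have x2 := exists_edge D.m2 D.hlk
  have x3 := exists_edge D.m3 D.hkb
  exact {
    a := I.a, b := I.b, Lu := I.L, M := I.M, Ru := I.R, Ll := I.L', Rl := I.R'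
    hM_ne := edges_ne_nil _ I.hab
    hPu := I.hA, hPl := I.hB
    hforest := I.forest
    hmeet := I.emeet
    hRu_ne := by
      rw [D.hR, Walk.edges_append]
      simp [edges_ne_nil D.ρ1 D.hr.symm]
    hLl_ne := by
      rw [D.hL', Walk.edges_append]
      simp [edges_ne_nil D.l2 D.hw]
    hRl_ne := by
      rw [D.hR', Walk.edges_append]
      simp [edges_ne_nil D.r1 D.hw'.symm]
    a1 := D.y, b1 := D.r, q1 := D.q1, S1 := D.S.append D.ρ1
    hq1path := D.pq1
    hq1_ne := edges_ne_nil _ D.hyr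
    hS1 := D.hS
    hq1closes := by
      intro x hx hx'
      simp only [msa] at hx'
      exact D.cq1 x hx (by tauto)
    hC1Ru := by
      obtain ⟨e, he⟩ := exists_edge D.ρ1 D.hr.symm
      exact ⟨e, by simp [he], by rw [D.hR]; simp [he]⟩
    hC1M := by grind
    a2 := D.w, b2 := D.k, q2 := D.q2, S2 := (D.l2.append D.m1).append D.m2
    hq2path := D.pq2
    hq2_ne := edges_ne_nil _ (by
      intro h
      have h1 := D.cq2 D.w (by simp)
      have h2 : D.w ∈ I.M.support := by rw [h, hM]; simp
      have h3 : D.w ∈ I.L'.support := by rw [hL']; simp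
      exact D.hw (I.LM' _ h3 h2))
    hS2 := ⟨D.l1.darts, D.m3.darts ++ I.R'.darts, by rw [hL', hM]; simp⟩
    hq2closes := by
      intro x hx hx'
      simp only [msa] at hx'
      have := D.cq2 x hx
      tauto
    hC2Ll := by
      obtain ⟨e, he⟩ := exists_edge D.l2 D.hw
      exact ⟨e, by simp [he], by rw [hL']; simp [he]⟩
    hC2M := by grind
    hMC2 := by grind
    a3 := D.l, b3 := D.w', q3 := D.q3, S3 := (D.m2.append D.m3).append D.r1
    hq3path := D.pq3
    hq3_ne := edges_ne_nil _ (by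
      intro h
      have h2 : D.w' ∈ I.M.support := by rw [← h, hM]; simp
      have h3 : D.w' ∈ I.R'.support := by rw [hR']; simp
      exact D.hw' (I.MR' _ h2 h3))
    hS3 := ⟨I.L'.darts ++ D.m1.darts, D.r2.darts, by rw [hR', hM]; simp⟩
    hq3closes := by
      intro x hx hx'
      simp only [msa] at hx'
      have := D.cq3 x hx
      tauto
    hC3Rl := by
      obtain ⟨e, he⟩ := exists_edge D.r1 D.hw'.symm
      exact ⟨e, by simp [he], by rw [hR']; simp [he]⟩
    hC3M := by grind
    hMC3 := by grind
    hC_ne := by grind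
    hC_sub := by
      intro e h1 h2 h3
      have := D.m2S
      have := hM' e
      grind
    hC1C2 := by grind
    hC1C3 := by
      obtain ⟨e, he⟩ := x3
      exact ⟨e, (hM' e).mpr (by tauto), S1 e (D.m3S he), (S3 e).mp (by tauto), g1 e he⟩ }

/-- BC1 / BC2 -/
theorem bc12 (h1 : ∀ x, x ∈ D.q1.support → x ∈ I.L'.support ∨ x ∈ I.R'.support → x = D.y) :
    ∃ B : PBC G s t s' t', B.IsBC := by
  refine ⟨D.pbc, ?_⟩
  have i1 : D.pbc.InternDisj D.q1 := by
    intro x hx hxa hxb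
    have := D.cq1 x hx
    have := h1 x hx
    change x ∉ ((I.L.append I.M).append I.R).support ∧ x ∉ ((I.L'.append I.M).append I.R').support
    simp only [msa]
    tauto
  have i2 : D.pbc.InternDisj D.q2 := by
    intro x hx hxa hxb
    have := D.cq2 x hx
    change x ∉ ((I.L.append I.M).append I.R).support ∧ x ∉ ((I.L'.append I.M).append I.R').support
    simp only [msa]
    tauto
  have i3 : D.pbc.InternDisj D.q3 := by
    intro x hx hxa hxb
    have := D.cq3 x hx
    change x ∉ ((I.L.append I.M).append I.R).support ∧ x ∉ ((I.L'.append I.M).append I.R').support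
    simp only [msa]
    tauto
  by_cases h : PBC.NodeDisj D.q1 D.q2
  · left
    exact ⟨h, D.d13, D.d23, i1, i2, i3⟩
  · right; left
    rcases D.d12 with h' | h'
    · exact absurd h' h
    · exact ⟨fun x h1 h2 => D.d13 x h2 h1, fun x h1 h2 => D.d23 x h2 h1, h, h', i1, i2, i3⟩

/-- BC3 / BC4 -/
theorem bc34 (hy : D.y = I.a) (hS : D.S.edges = I.M.edges)
    (h1 : ∀ x, x ∈ D.q1.support → x ∉ I.R'.support) (h2 : D.w ∉ D.q1.support)
    (h3 : ∃ (z : V) (α : G.Walk D.y z) (β : G.Walk z D.r), D.q1 = α.append β ∧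
      z ∈ I.L'.support ∧ (∀ e ∈ α.edges, e ∈ D.l2.edges) ∧
      ∀ x ∈ β.support, x ∈ I.L'.support → x = z) :
    ∃ B : PBC G s t s' t', B.IsBC := by
  refine ⟨D.pbc, ?_⟩
  have i0 : D.pbc.Small := by
    intro e he hL
    change e ∈ (D.S.append D.ρ1).edges at he
    change e ∈ I.L.edges at hL
    have := I.hA.isTrail.edges_nodup
    rw [D.hR] at this
    simp only [Walk.edges_append, List.nodup_append, List.mem_append, hS] at this he
    grind
  have i1 : ∀ e ∈ D.pbc.M.edges, e ∈ D.pbc.S1.edges := by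
    intro e he
    change e ∈ I.M.edges at he
    change e ∈ (D.S.append D.ρ1).edges
    simp only [mea, hS]
    tauto
  have i2 : D.pbc.AvoidsUpperOuter D.q2 := fun x hx => (D.cq2 x hx).2.2.2
  have i3 : D.pbc.AvoidsUpperOuter D.q3 := fun x hx => (D.cq3 x hx).2.2.2
  have i4 : D.pbc.LlTraverse := by
    refine ⟨h1, h2, ?_⟩
    obtain ⟨z, α, β, e1, e2, e3, e4⟩ := h3
    refine ⟨z, α, β, e1, e2, ?_, e4⟩
    intro e he
    change e ∈ ((D.l2.append D.m1).append D.m2).edges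
    simp [e3 e he]
  by_cases h : PBC.NodeDisj D.q1 D.q2
  · right; right; left
    exact ⟨i0, i1, h, D.d13, D.d23, i2, i3, i4⟩
  · right; right; right
    rcases D.d12 with h' | h'
    · exact absurd h' h
    · exact ⟨i0, i1, fun x h1 h2 => D.d13 x h2 h1, fun x h1 h2 => D.d23 x h2 h1, h, h', i2, i3, i4⟩

end Raw
end NDG
end Part6

section Part7
namespace NDG
open SimpleGraph
variable {V : Type*} [DecidableEq V] {G : SimpleGraph V}

theorem darts_reverse_reverse {u v : V} (p : G.Walk u v) : p.reverse.reverse.darts = p.darts := by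
  rw [Walk.reverse_reverse]

theorem exchange {c : Sym2 V → ℝ} {x y x' z u v w k : V} {W : G.Walk x z} {W0 : G.Walk x y}
    {r : V} {β : G.Walk y r} {W1 : G.Walk r z}
    {V1 : G.Walk x' k} {A : G.Walk x' w} {q2 : G.Walk w k}
    (hW : W = (W0.append β).append W1) (hV : V1 = A.append q2)
    (pW : W.IsPath) (pV : V1.IsPath) (Z : Finset (Sym2 V))
    (hZ1 : ∀ e ∈ β.edges, e ∉ Z) (hZ2 : ∀ e ∈ q2.edges, e ∉ Z) :
    (∀ x, x ∈ β.support → x ∉ q2.support) ∨ PBC.CommonMid β q2 ∨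
    (∃ W' : G.Walk x z, wc c W' ≤ wc c W ∧
      (W'.edges.toFinset ∪ V1.edges.toFinset ∪ Z).card <
      (W.edges.toFinset ∪ V1.edges.toFinset ∪ Z).card) ∨
    (∃ V1' : G.Walk x' k, wc c V1' ≤ wc c V1 ∧
      (W.edges.toFinset ∪ V1'.edges.toFinset ∪ Z).card <
      (W.edges.toFinset ∪ V1.edges.toFinset ∪ Z).card) := by
  by_cases hcom : ∀ x, x ∈ β.support → x ∉ q2.support
  · exact Or.inl hcom
  right
  push Not at hcom
  obtain ⟨p, β0, β', eβ, hp, hfirst⟩ := first_hit (fun x => x ∈ q2.support) β hcom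
  obtain ⟨p', σ, β1, eβ', hp', hlast⟩ := last_hit (fun x => x ∈ q2.support) β' ⟨p, by simp, hp⟩
  have mid : ∀ s, s ∈ β.support → s ∈ q2.support → s ∈ σ.support := by
    intro s h1 h2
    rw [eβ, msa, eβ', msa] at h1
    rcases h1 with h1 | h1 | h1
    · rw [hfirst s h1 h2]; simp
    · exact h1
    · rw [hlast s h1 h2]; simp
  have dσ : σ.darts <:+: β.darts := ⟨β0.darts, β1.darts, by rw [eβ, eβ']; simp⟩
  have eW : W = ((W0.append β0).append σ).append (β1.append W1) := by
    rw [hW, eβ, eβ']; simp only [Walk.append_assoc]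
  have pσ : σ.IsPath := by
    rw [eW] at pW
    exact (path_append.mp (path_append.mp pW).1).2.1
  have hσZ : ∀ e ∈ σ.edges, e ∉ Z := by
    intro e he
    apply hZ1; rw [eβ, eβ']; simp [he]
  obtain ⟨γ0, γ', eq⟩ := split hp
  have hp'' := hp'
  rw [eq, msa] at hp''
  have cardcomm : ∀ (a b : Finset (Sym2 V)), a ∪ b ∪ Z = b ∪ a ∪ Z := by
    intro a b; rw [Finset.union_comm a b]
  rcases hp'' with h | h
  · obtain ⟨γ00, τ, eγ⟩ := split h
    have eV : V1 = ((A.append γ00).append τ).append γ' := by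
      rw [hV, eq, eγ]; simp only [Walk.append_assoc]
    have pτ : τ.IsPath := by
      rw [eV] at pV
      exact (path_append.mp (path_append.mp pV).1).2.1
    have hτZ : ∀ e ∈ τ.edges, e ∉ Z := by
      intro e he
      apply hZ2; rw [eq, eγ]; simp [he]
    have fin : ∀ (_ : σ = τ.reverse), PBC.CommonMid β q2 := by
      intro h
      refine ⟨p, p', σ, pσ, dσ, Or.inr ?_, mid⟩
      rw [h, Walk.reverse_reverse]
      exact ⟨γ00.darts, γ'.darts, by rw [eq, eγ]; simp⟩
    by_cases hle : wc c τ ≤ wc c σ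
    · rcases exch_card (A := W0.append β0) (σ := σ) (B := β1.append W1) (τ := τ.reverse) (R := V1)
        (Z := Z) (by rw [← eW]; exact pW) (by simpa using pτ) pV
        (by rw [eV]; intro e; simp only [mea, mer]; tauto) hσZ with h | h
      · exact Or.inl (fin h)
      · right; left
        refine ⟨_, ?_, by rw [← eW] at h; exact h⟩
        rw [eW]; simp only [wc_append, wc_reverse]; linarith
    · rcases exch_card (A := A.append γ00) (σ := τ) (B := γ') (τ := σ.reverse) (R := W)
        (Z := Z) (by rw [← eV]; exact pV) (by simpa using pσ) pW
        (by rw [eW]; intro e; simp only [mea, mer]; tauto) hτZ with h | h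
      · exact Or.inl (fin (by rw [h, Walk.reverse_reverse]))
      · right; right
        refine ⟨((A.append γ00).append σ.reverse).append γ', ?_, by
          rw [← eV, cardcomm, cardcomm V1.edges.toFinset] at h; exact h⟩
        rw [eV]; simp only [wc_append, wc_reverse]; linarith
  · obtain ⟨τ, γ1, eγ⟩ := split h
    have eV : V1 = ((A.append γ0).append τ).append γ1 := by
      rw [hV, eq, eγ]; simp only [Walk.append_assoc]
    have pτ : τ.IsPath := by
      rw [eV] at pV
      exact (path_append.mp (path_append.mp pV).1).2.1
    have hτZ : ∀ e ∈ τ.edges, e ∉ Z := by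
      intro e he
      apply hZ2; rw [eq, eγ]; simp [he]
    have fin : ∀ (_ : σ = τ), PBC.CommonMid β q2 := by
      intro h
      refine ⟨p, p', σ, pσ, dσ, Or.inl ?_, mid⟩
      rw [h]
      exact ⟨γ0.darts, γ1.darts, by rw [eq, eγ]; simp⟩
    by_cases hle : wc c τ ≤ wc c σ
    · rcases exch_card (A := W0.append β0) (σ := σ) (B := β1.append W1) (τ := τ) (R := V1)
        (Z := Z) (by rw [← eW]; exact pW) pτ pV
        (by rw [eV]; intro e; simp only [mea, mer]; tauto) hσZ with h | h
      · exact Or.inl (fin h)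
      · right; left
        refine ⟨_, ?_, by rw [← eW] at h; exact h⟩
        rw [eW]; simp only [wc_append, wc_reverse]; linarith
    · rcases exch_card (A := A.append γ0) (σ := τ) (B := γ1) (τ := σ) (R := W)
        (Z := Z) (by rw [← eV]; exact pV) pσ pW
        (by rw [eW]; intro e; simp only [mea, mer]; tauto) hτZ with h | h
      · exact Or.inl (fin h.symm)
      · right; right
        refine ⟨((A.append γ0).append σ).append γ1, ?_, by
          rw [← eV, cardcomm, cardcomm V1.edges.toFinset] at h; exact h⟩
        rw [eV]; simp only [wc_append, wc_reverse]; linarith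

theorem commonMid_prefix {a y r w k : V} {α : G.Walk a y} {β : G.Walk y r} {q : G.Walk w k}
    (h : PBC.CommonMid β q) (hα : ∀ x, x ∈ α.support → x ∉ q.support) :
    PBC.CommonMid (α.append β) q := by
  obtain ⟨c, d, m, h1, h2, h3, h4⟩ := h
  refine ⟨c, d, m, h1, ?_, h3, ?_⟩
  · rw [Walk.darts_append]
    exact h2.trans (List.suffix_append _ _).isInfix
  · intro s hs hq
    rw [msa] at hs
    rcases hs with hs | hs
    · exact absurd hq (hα s hs)
    · exact h4 s hs hq

end NDG
end Part7

section Part8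
namespace NDG
open SimpleGraph
variable {V : Type*} [DecidableEq V] {G : SimpleGraph V}
variable {s t s' t' : V} 

/-- lower half of the raw data of a bad configuration -/
structure BRaw (I : Shape G s t s' t') {w k l w' : V} (q2 : G.Walk w k) (q3 : G.Walk l w') where
  m1 : G.Walk I.a l
  m2 : G.Walk l k
  m3 : G.Walk k I.b
  hM : I.M = (m1.append m2).append m3
  hlk : l ≠ k
  hkb : k ≠ I.b
  hla : l ≠ I.a
  l1 : G.Walk s' w
  l2 : G.Walk w I.a
  hL' : I.L' = l1.append l2
  hw : w ≠ I.a
  r1 : G.Walk I.b w'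
  r2 : G.Walk w' t'
  hR' : I.R' = r1.append r2
  hw' : w' ≠ I.b
  pq2 : q2.IsPath
  cq2 : ∀ x, x ∈ q2.support → (x ∈ I.L'.support → x = w) ∧ (x ∈ I.M.support → x = k) ∧
    x ∉ I.R'.support ∧ x ∉ I.L.support ∧ x ∉ I.R.support
  pq3 : q3.IsPath
  cq3 : ∀ x, x ∈ q3.support → (x ∈ I.R'.support → x = w') ∧ (x ∈ I.M.support → x = l) ∧
    x ∉ I.L'.support ∧ x ∉ I.L.support ∧ x ∉ I.R.support
  d23 : ∀ x, x ∈ q2.support → x ∉ q3.support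

namespace BRaw
variable {I : Shape G s t s' t'} {w k l w' : V} {q2 : G.Walk w k} {q3 : G.Walk l w'}

theorem fin12 (D : BRaw I q2 q3) {y r : V} (β : G.Walk y r) (pβ : β.IsPath)
    (hr : r ∈ I.R.support) (hrb : r ≠ I.b)
    (hy : y ∈ I.L.support ∨ (y ∈ D.m1.support ∧ y ≠ l))
    (cβ : ∀ x, x ∈ β.support → x ∈ I.L.support ∨ x ∈ I.M.support ∨ x ∈ I.L'.support ∨
      x ∈ I.R'.support → x = y)
    (cβR : ∀ x, x ∈ β.support → x ∈ I.R.support → x = r)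
    (d13 : ∀ x, x ∈ β.support → x ∉ q3.support)
    (d12 : (∀ x, x ∈ β.support → x ∉ q2.support) ∨ PBC.CommonMid β q2) :
    ∃ B : PBC G s t s' t', B.IsBC := by
  obtain ⟨ρ1, ρ2, hR⟩ := split hr
  obtain ⟨S, hS, h1, h2, h3⟩ : ∃ S : G.Walk y I.b,
      (S.append ρ1).darts <:+: ((I.L.append I.M).append I.R).darts ∧
      D.m2.edges ⊆ S.edges ∧ D.m3.edges ⊆ S.edges ∧ ∃ e ∈ D.m1.edges, e ∈ S.edges := by
    rcases hy with hy | ⟨hy, hyl⟩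
    · obtain ⟨ν1, ν2, hL⟩ := split hy
      obtain ⟨e, he⟩ := exists_edge D.m1 D.hla.symm
      refine ⟨ν2.append I.M, ⟨ν1.darts, ρ2.darts, by rw [hL, hR]; simp⟩, ?_, ?_, e, he, ?_⟩
      · rw [D.hM]; intro e; simp only [mea]; tauto
      · rw [D.hM]; intro e; simp only [mea]; tauto
      · rw [D.hM]; simp only [mea]; tauto
    · obtain ⟨μ1, μ2, hm⟩ := split hy
      obtain ⟨e, he⟩ := exists_edge μ2 hyl
      refine ⟨(μ2.append D.m2).append D.m3, ⟨I.L.darts ++ μ1.darts, ρ2.darts, by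
        rw [D.hM, hm, hR]; simp⟩, ?_, ?_, e, ?_, ?_⟩
      · intro e; simp only [mea]; tauto
      · intro e; simp only [mea]; tauto
      · rw [hm]; simp only [mea]; tauto
      · simp only [mea]; tauto
  have hyr : y ≠ r := by
    rintro rfl
    rcases hy with hy | ⟨hy, hyl⟩
    · exact I.LR _ hy hr
    · exact hrb (I.MR _ (by rw [D.hM]; simp only [msa]; tauto) hr)
  let E : Raw I := { D with
    k := k, l := l, w := w, w' := w', y := y, r := r, q2 := q2, q3 := q3
    ρ1 := ρ1, ρ2 := ρ2, hR := hR, hr := hrb, S := S, hS := hS, m2S := h1, m3S := h2, m1S := h3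
    q1 := β, pq1 := pβ, hyr := hyr, d13 := d13, d12 := d12
    cq1 := by
      intro x hx
      have := cβ x hx
      have := cβR x hx
      tauto }
  exact E.bc12 (by
    intro x hx h
    exact cβ x hx (by tauto))

theorem fin34 (D : BRaw I q2 q3) {y r : V} (β : G.Walk y r) (pβ : β.IsPath)
    (hr : r ∈ I.R.support) (hrb : r ≠ I.b)
    (hy : y ∈ D.l2.support) (hyw : y ≠ w) (hya : y ≠ I.a)
    (cβ : ∀ x, x ∈ β.support → x ∈ I.L.support ∨ x ∈ I.M.support ∨ x ∈ I.L'.support ∨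
      x ∈ I.R'.support → x = y)
    (cβR : ∀ x, x ∈ β.support → x ∈ I.R.support → x = r)
    (d13 : ∀ x, x ∈ β.support → x ∉ q3.support)
    (d12 : (∀ x, x ∈ β.support → x ∉ q2.support) ∨ PBC.CommonMid β q2) :
    ∃ B : PBC G s t s' t', B.IsBC := by
  obtain ⟨ρ1, ρ2, hR⟩ := split hr
  obtain ⟨ν1, ν2, hl⟩ := split hy
  have hyL' : y ∈ I.L'.support := by rw [D.hL']; simp only [msa]; tauto
  have sub : ∀ x, x ∈ ν2.support → x ∈ I.L'.support := by
    intro x hx; rw [D.hL', hl]; simp only [msa]; tauto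
  have pL := I.pL'
  rw [D.hL', hl] at pL
  have pl2 := (path_append.mp pL).2.1
  have pν2 := (path_append.mp pl2).2.1
  have hwν : w ∉ ν2.support := by
    intro h
    exact hyw ((path_append.mp pl2).2.2 w (by simp) h).symm
  have hyr : I.a ≠ r := by
    rintro rfl
    exact I.LR I.a (by simp) hr
  have dα : ∀ x, x ∈ ν2.reverse.support → x ∉ q2.support := by
    intro x hx hq
    rw [msr] at hx
    have := (D.cq2 x hq).1 (sub x hx)
    subst this
    exact hwν hx
  let E : Raw I := { D with
    k := k, l := l, w := w, w' := w', y := I.a, r := r, q2 := q2, q3 := q3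
    ρ1 := ρ1, ρ2 := ρ2, hR := hR, hr := hrb, S := I.M
    hS := ⟨I.L.darts, ρ2.darts, by rw [hR]; simp⟩
    m2S := by rw [D.hM]; intro e; simp only [mea]; tauto
    m3S := by rw [D.hM]; intro e; simp only [mea]; tauto
    m1S := by
      obtain ⟨e, he⟩ := exists_edge D.m1 D.hla.symm
      exact ⟨e, he, by rw [D.hM]; simp only [mea]; tauto⟩
    q1 := ν2.reverse.append β
    pq1 := by
      rw [path_append]
      refine ⟨by simpa using pν2, pβ, ?_⟩
      intro x hx hx'
      rw [msr] at hx
      exact cβ x hx' (by have := sub x hx; tauto)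
    hyr := hyr
    d13 := by
      intro x hx hq
      rw [msa, msr] at hx
      rcases hx with hx | hx
      · exact (D.cq3 x hq).2.2.1 (sub x hx)
      · exact d13 x hx hq
    d12 := by
      rcases d12 with h | h
      · left
        intro x hx hq
        rw [msa] at hx
        rcases hx with hx | hx
        · exact dα x hx hq
        · exact h x hx hq
      · right
        exact commonMid_prefix h dα
    cq1 := by
      intro x hx hx'
      rw [msa, msr] at hx
      rcases hx with hx | hx
      · left
        have h1 := sub x hx
        rcases hx' with h | h | h
        · exact I.dLL x h h1
        · exact I.LM' x h1 h
        · exact absurd h1 (I.dRL x h)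
      · rcases hx' with h | h | h
        · have := cβ x hx (by tauto)
          subst this
          exact absurd (I.dLL x h hyL') hya
        · have := cβ x hx (by tauto)
          subst this
          exact absurd (I.LM' x hyL' h) hya
        · right; exact cβR x hx h }
  refine E.bc34 rfl rfl ?_ ?_ ⟨y, ν2.reverse, β, rfl, hyL', ?_, ?_⟩
  · intro x hx hR'
    change x ∈ (ν2.reverse.append β).support at hx
    rw [msa, msr] at hx
    rcases hx with hx | hx
    · exact I.LR' x (sub x hx) hR'
    · have := cβ x hx (by tauto)
      subst this
      exact I.LR' x hyL' hR'
  · change w ∉ (ν2.reverse.append β).support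
    rw [msa, msr]
    rintro (h | h)
    · exact hwν h
    · exact hyw (cβ w h (Or.inr (Or.inr (Or.inl (by rw [D.hL']; simp))))).symm
  · intro e he
    change e ∈ D.l2.edges
    rw [mer] at he
    rw [hl, mea]; tauto
  · intro x hx h
    exact cβ x hx (by tauto)

end BRaw

/-- lower half from an overlapping detour situation -/
theorem BP.raw {c : Sym2 V → ℝ} {I : Inst c G s t s' t'} {κ : ℝ} {k l w w' : V}
    {A : G.Walk s' w} {q2 : G.Walk w k} {q3 : G.Walk l w'} {A' : G.Walk w' t'}
    (h : BP I κ (A.append q2) (q3.append A')) (p1 : (A.append q2).IsPath)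
    (p2 : (q3.append A').IsPath)
    (hw : w ∈ I.L'.support) (c1 : ∀ x, x ∈ q2.support → x ∈ I.L'.support → x = w)
    (c2 : ∀ x, x ∈ q2.support → x ∈ I.M.support → x = k)
    (hw' : w' ∈ I.R'.support) (c3 : ∀ x, x ∈ q3.support → x ∈ I.R'.support → x = w')
    (c4 : ∀ x, x ∈ q3.support → x ∈ I.M.support → x = l) :
    Nonempty (BRaw I.toShape q2 q3) := by
  obtain ⟨m1, m2, m3, hM⟩ := I.ordered_lt h.lM h.kM h.hlk
  obtain ⟨l1, l2, hL'⟩ := split hw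
  obtain ⟨r1, r2, hR'⟩ := split hw'
  have s1 : ∀ x, x ∈ q2.support → x ∈ (A.append q2).support := by
    intro x hx; rw [msa]; tauto
  have s2 : ∀ x, x ∈ q3.support → x ∈ (q3.append A').support := by
    intro x hx; rw [msa]; tauto
  exact ⟨{
    m1 := m1, m2 := m2, m3 := m3, hM := hM
    hlk := by rintro rfl; exact lt_irrefl _ h.hlk
    hkb := by intro e; exact h.V1R k (s1 _ (by simp)) (by rw [e]; simp)
    hla := by intro e; exact h.V2L l (s2 _ (by simp)) (by rw [e]; simp)
    l1 := l1, l2 := l2, hL' := hL'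
    hw := by intro e; exact h.V1L w (s1 _ (by simp)) (by rw [e]; simp)
    r1 := r1, r2 := r2, hR' := hR'
    hw' := by intro e; exact h.V2R w' (s2 _ (by simp)) (by rw [e]; simp)
    pq2 := (path_append.mp p1).2.1
    pq3 := (path_append.mp p2).1
    cq2 := fun x hx => ⟨c1 x hx, c2 x hx, h.V1R' x (s1 x hx), h.V1L x (s1 x hx), h.V1R x (s1 x hx)⟩
    cq3 := fun x hx => ⟨c3 x hx, c4 x hx, h.V2L' x (s2 x hx), h.V2L x (s2 x hx), h.V2R x (s2 x hx)⟩
    d23 := fun x hx hx' => h.dV x (s1 x hx) (s2 x hx') }⟩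

end NDG
end Part8

section Part9
namespace NDG
open SimpleGraph
variable {V : Type*} [DecidableEq V] {G : SimpleGraph V}
variable {c : Sym2 V → ℝ} {s t s' t' : V}

theorem split2 {u v x y : V} {p : G.Walk u v} (hx : x ∈ p.support) (hy : y ∈ p.support) :
    (∃ (X : G.Walk u x) (Y : G.Walk x y) (Z : G.Walk y v), p = X.append (Y.append Z)) ∨
    (∃ (X : G.Walk u y) (Y : G.Walk y x) (Z : G.Walk x v), p = X.append (Y.append Z)) := by
  obtain ⟨K1, K2, hK⟩ := split hx
  obtain ⟨J1, J2, hJ⟩ := split hy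
  rcases two_splits hK hJ with ⟨X, e1, e2⟩ | ⟨X, e1, e2⟩
  · left; exact ⟨K1, X, J2, by rw [hK, e2]⟩
  · right; exact ⟨J1, X, K2, by rw [hJ, e2]⟩

theorem between {u v x y : V} {p : G.Walk u v} (hx : x ∈ p.support) (hy : y ∈ p.support) :
    ∃ X : G.Walk x y, ∀ e ∈ X.edges, e ∈ p.edges := by
  rcases split2 hx hy with ⟨X, Y, Z, rfl⟩ | ⟨X, Y, Z, rfl⟩
  · exact ⟨Y, by intro e; simp only [mea]; tauto⟩
  · exact ⟨Y.reverse, by intro e; simp only [mea, mer]; tauto⟩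

namespace BP
variable {I : Inst c G s t s' t'} {W : G.Walk s t} {k l : V} {V1 : G.Walk s' k} {V2 : G.Walk l t'}

theorem f3 (h : BP I (wc c W) V1 V2) : ∀ p, p ∈ W.support → p ∈ I.M.support →
    I.C p < I.C l ∨ I.C k < I.C p := by
  intro p hp hpM
  by_contra hcon
  push Not at hcon
  obtain ⟨U1, U2, rfl⟩ := split hp
  have h1 := I.o1 U1 V1 hpM h.kM
  have h2 := I.o2 U2 V2 hpM h.lM
  rw [min_eq_left hcon.2] at h1
  rw [max_eq_left hcon.1] at h2
  have := h.N
  rw [wc_append] at this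
  linarith

theorem f6 (h : BP I (wc c W) V1 V2) : ∀ z z', z ∈ W.support → z ∈ I.L'.support →
    z' ∈ W.support → z' ∈ I.R'.support → False := by
  intro z z' hz hzL hz' hzR
  obtain ⟨X, hX⟩ := between hz hz'
  obtain ⟨L1, L2, eL⟩ := split hzL
  obtain ⟨R1, R2, eR⟩ := split hzR
  have := I.opt' W ((L1.append X).append R2) (W.edges ++ I.L'.edges ++ I.R'.edges)
    (by intro e; simp only [mea, mer, List.mem_append]; grind)
    (by intro e; rw [eL, eR]; simp only [mea, mer, List.mem_append]; grind)
  have h1 := I.b_s' V1 h.kM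
  have h2 := I.b_t' V2 h.lM
  have := h.N
  simp only [lc_append, lc_edges] at *
  linarith

theorem f7 (h : BP I (wc c W) V1 V2) : ∀ z p, z ∈ W.support → z ∈ I.L'.support →
    p ∈ W.support → p ∈ I.M.support → I.C p < I.C l := by
  intro z p hz hzL hp hpM
  by_contra hcon
  push Not at hcon
  obtain ⟨L1, L2, eL⟩ := split hzL
  obtain ⟨K1, K2, e', h1, h2, h3, h4⟩ := I.pre hpM
  obtain ⟨J1, J2, ej', j1, j2, j3, j4⟩ := I.pre h.lM
  have hN := h.N
  rcases split2 hz hp with ⟨X, Y, Z, e⟩ | ⟨X, Y, Z, e⟩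
  · have h5 := I.opt' (((X.append Y).append K2).append I.R) (((L1.append Y).append K2).append I.R')
      (X.edges ++ Y.edges ++ I.L'.edges ++ K2.edges ++ I.R.edges ++ I.R'.edges)
      (by intro e; simp only [mea, mer, List.mem_append]; grind)
      (by intro e; rw [eL]; simp only [mea, mer, List.mem_append]; grind)
    have h6 := I.o2 Z V2 hpM h.lM
    rw [max_eq_left hcon] at h6
    have h7 := I.b_s' V1 h.kM
    rw [e] at hN
    simp only [lc_append, lc_edges, wc_append, wc_reverse] at *
    linarith
  · have h5 := I.opt' ((I.L.append L2.reverse).append Z) ((I.L'.append J1).append V2)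
      (I.L.edges ++ I.L'.edges ++ J1.edges ++ Z.edges ++ V2.edges)
      (by intro e; rw [eL]; simp only [mea, mer, List.mem_append]; grind)
      (by intro e; simp only [mea, mer, List.mem_append]; grind)
    have h6 := I.o1 X V1 hpM h.kM
    have h7 : I.C l ≤ min (I.C p) (I.C k) := le_min hcon h.hlk.le
    rw [e] at hN
    have := wc_nonneg I.c0 Y
    simp only [lc_append, lc_edges, wc_append, wc_reverse] at *
    linarith

theorem f8 (h : BP I (wc c W) V1 V2) : ∀ p q, p ∈ W.support → p ∈ I.M.support →
    q ∈ W.support → q ∈ I.M.support → I.C p < I.C l → I.C k < I.C q → False := by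
  intro p q hp hpM hq hqM hpl hqk
  have hN := h.N
  have hlk := h.hlk
  rcases split2 hp hq with ⟨X, Y, Z, e⟩ | ⟨X, Y, Z, e⟩
  · have h1 := I.o1 X V1 hpM h.kM
    have h2 := I.o2 Z V2 hqM h.lM
    have h3 := (I.b_M' Y hpM hqM).1
    rw [min_eq_left (by linarith)] at h1
    rw [max_eq_left (by linarith)] at h2
    rw [e] at hN
    simp only [wc_append] at *
    linarith
  · have h1 := I.o1 X V1 hqM h.kM
    have h2 := I.o2 Z V2 hpM h.lM
    have h3 := wc_nonneg I.c0 Y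
    rw [min_eq_right (by linarith)] at h1
    rw [max_eq_right (by linarith)] at h2
    rw [e] at hN
    simp only [wc_append] at *
    linarith

theorem f5 (h : BP I (wc c W) V1 V2) : ∀ p q, p ∈ W.support → p ∈ V1.support →
    q ∈ W.support → q ∈ V2.support → False := by
  intro z z' hz hzL hz' hzR
  obtain ⟨X, hX⟩ := between hz hz'
  obtain ⟨L1, L2, eL⟩ := split hzL
  obtain ⟨R1, R2, eR⟩ := split hzR
  have := I.opt' W ((L1.append X).append R2) (W.edges ++ V1.edges ++ V2.edges)
    (by intro e; simp only [mea, mer, List.mem_append]; grind)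
    (by intro e; rw [eL, eR]; simp only [mea, mer, List.mem_append]; grind)
  have := h.N
  simp only [lc_append, lc_edges] at *
  linarith

theorem f11 (h : BP I (wc c W) V1 V2) : ∀ p q, p ∈ W.support → p ∈ I.L'.support →
    q ∈ W.support → q ∈ V2.support → False := by
  intro z z' hz hzL hz' hzR
  obtain ⟨X, hX⟩ := between hz hz'
  obtain ⟨L1, L2, eL⟩ := split hzL
  obtain ⟨R1, R2, eR⟩ := split hzR
  have := I.opt' W ((L1.append X).append R2) (W.edges ++ I.L'.edges ++ V2.edges)
    (by intro e; simp only [mea, mer, List.mem_append]; grind)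
    (by intro e; rw [eL, eR]; simp only [mea, mer, List.mem_append]; grind)
  have h1 := I.b_s' V1 h.kM
  have := h.N
  simp only [lc_append, lc_edges] at *
  linarith

theorem f9 (h : BP I (wc c W) V1 V2) {i : V} {U1 : G.Walk s i} {U2 : G.Walk i t}
    (e : W = U1.append U2) (hi : i ∈ I.M.support) (hil : I.C i < I.C l) :
    ∀ p, p ∈ U2.support → p ∉ V2.support := by
  intro p hp hp'
  obtain ⟨X, Y, eU⟩ := split hp
  obtain ⟨D1, D2, eV⟩ := split hp'
  obtain ⟨K1, K2, e', h1, h2, h3, h4⟩ := I.pre hi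
  have h5 := I.opt' ((I.L.append K1).append U2) (((I.L'.append K1).append X).append D2)
      (I.L.edges ++ I.L'.edges ++ K1.edges ++ U2.edges ++ V2.edges)
      (by intro e; simp only [mea, mer, List.mem_append]; grind)
      (by intro e; rw [eU, eV]; simp only [mea, mer, List.mem_append]; grind)
  have h6 := I.o1 U1 V1 hi h.kM
  have := h.hlk
  rw [min_eq_left (by linarith)] at h6
  have hN := h.N
  rw [e] at hN
  simp only [lc_append, lc_edges, wc_append, wc_reverse] at *
  linarith

theorem f10 (h : BP I (wc c W) V1 V2) {p z : V} {X : G.Walk s p} {Y : G.Walk p z} {Z : G.Walk z t}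
    (e : W = X.append (Y.append Z)) (hp : p ∈ V1.support) (hz : z ∈ I.L'.support) : False := by
  obtain ⟨L1, L2, eL⟩ := split hz
  obtain ⟨D1, D2, eV⟩ := split hp
  obtain ⟨K1, K2, e', h1, h2, h3, h4⟩ := I.pre h.kM
  obtain ⟨J1, J2, ej', j1, j2, j3, j4⟩ := I.pre h.lM
  have h5 := I.opt' (((X.append D2).append K2).append I.R) ((V1.append K2).append I.R')
      (X.edges ++ V1.edges ++ K2.edges ++ I.R.edges ++ I.R'.edges)
      (by intro e; rw [eV]; simp only [mea, mer, List.mem_append]; grind)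
      (by intro e; simp only [mea, mer, List.mem_append]; grind)
  have h6 := I.opt' ((I.L.append L2.reverse).append Z) ((I.L'.append J1).append V2)
      (I.L.edges ++ I.L'.edges ++ J1.edges ++ Z.edges ++ V2.edges)
      (by intro e; rw [eL]; simp only [mea, mer, List.mem_append]; grind)
      (by intro e; simp only [mea, mer, List.mem_append]; grind)
  have hN := h.N
  have := h.hlk
  have := wc_nonneg I.c0 Y
  rw [e] at hN
  simp only [lc_append, lc_edges, wc_append, wc_reverse] at *
  linarith

end BP
end NDG
end Part9

section Part10
namespace NDG
open SimpleGraph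
variable {V : Type*} [DecidableEq V] {G : SimpleGraph V}
variable {c : Sym2 V → ℝ} {s t s' t' : V}

theorem BRaw.low {c : Sym2 V → ℝ} {I : Inst c G s t s' t'} {w k l w' : V}
    {q2 : G.Walk w k} {q3 : G.Walk l w'} (D : BRaw I.toShape q2 q3) {y : V}
    (hy : y ∈ I.M.support) (hyl : I.C y < I.C l) : y ∈ D.m1.support := by
  have hM := D.hM
  rw [hM] at hy
  simp only [msa] at hy
  have hl := (I.C_eq (K1 := D.m1) (K2 := D.m2.append D.m3) (by rw [hM, Walk.append_assoc]))
  rcases hy with (hy | hy) | hy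
  · exact hy
  · obtain ⟨X, Y, e⟩ := split hy
    have := I.C_eq (p := y) (K1 := D.m1.append X) (K2 := Y.append D.m3) (by
      rw [hM, e]; simp only [Walk.append_assoc])
    rw [wc_append] at this
    have := wc_nonneg I.c0 X
    linarith
  · obtain ⟨X, Y, e⟩ := split hy
    have := I.C_eq (p := y) (K1 := (D.m1.append D.m2).append X) (K2 := Y) (by
      rw [hM, e]; simp only [Walk.append_assoc])
    simp only [wc_append] at this
    have := wc_nonneg I.c0 X
    have := wc_nonneg I.c0 D.m2
    linarith

set_option maxHeartbeats 2000000 in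
theorem S1_left {I : Inst c G s t s' t'} {W : G.Walk s t} {w k l w' : V}
    {A : G.Walk s' w} {q2 : G.Walk w k} {q3 : G.Walk l w'} {A' : G.Walk w' t'}
    (h : BP I (wc c W) (A.append q2) (q3.append A')) (p1 : (A.append q2).IsPath)
    (p2 : (q3.append A').IsPath) (pW : W.IsPath)
    (hw : w ∈ I.L'.support) (c1 : ∀ x, x ∈ q2.support → x ∈ I.L'.support → x = w)
    (c2 : ∀ x, x ∈ q2.support → x ∈ I.M.support → x = k)
    (hw' : w' ∈ I.R'.support) (c3 : ∀ x, x ∈ q3.support → x ∈ I.R'.support → x = w')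
    (c4 : ∀ x, x ∈ q3.support → x ∈ I.M.support → x = l)
    (hWR : ∀ x, x ∈ W.support → x ∉ I.R'.support)
    (hWM : ∀ x, x ∈ W.support → x ∈ I.M.support → I.C x < I.C l)
    (hWV : (∀ x, x ∈ W.support → x ∉ I.M.support ∧ x ∉ I.L'.support) →
      ∀ x, x ∈ W.support → x ∉ (q3.append A').support)
    (IHW : ∀ W' : G.Walk s t, wc c W' ≤ wc c W →
      (W'.edges.toFinset ∪ (A.append q2).edges.toFinset ∪ (q3.append A').edges.toFinset).card <
      (W.edges.toFinset ∪ (A.append q2).edges.toFinset ∪ (q3.append A').edges.toFinset).card → False)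
    (IHV : ∀ V' : G.Walk s' k, wc c V' ≤ wc c (A.append q2) →
      (W.edges.toFinset ∪ V'.edges.toFinset ∪ (q3.append A').edges.toFinset).card <
      (W.edges.toFinset ∪ (A.append q2).edges.toFinset ∪ (q3.append A').edges.toFinset).card → False) :
    False := by
  obtain ⟨D⟩ := h.raw p1 p2 hw c1 c2 hw' c3 c4
  obtain ⟨y, W0, B, eW, hy, hB⟩ := last_hit
    (fun x => x ∈ I.L.support ∨ x ∈ I.M.support ∨ x ∈ I.L'.support) W ⟨s, by simp, by simp⟩
  obtain ⟨r, β, W1, eB, hr, hβ⟩ := first_hit (fun x => x ∈ I.R.support) B ⟨t, by simp, by simp⟩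
  have sB : ∀ x, x ∈ β.support → x ∈ B.support := by
    intro x hx; rw [eB, msa]; tauto
  have sW : ∀ x, x ∈ B.support → x ∈ W.support := by
    intro x hx; rw [eW, msa]; tauto
  have eW' : W = (W0.append β).append W1 := by rw [eW, eB, Walk.append_assoc]
  have pβ : β.IsPath := by
    rw [eW'] at pW
    exact (path_append.mp (path_append.mp pW).1).2.1
  have hrb : r ≠ I.b := by
    rintro rfl
    have := hWM I.b (sW _ (sB _ (by simp))) (by simp)
    rw [I.C_b] at this
    have := I.C_le h.lM
    linarith
  have cβ : ∀ x, x ∈ β.support → x ∈ I.L.support ∨ x ∈ I.M.support ∨ x ∈ I.L'.support ∨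
      x ∈ I.R'.support → x = y := by
    intro x hx hx'
    rcases hx' with hx' | hx' | hx' | hx'
    · exact hB x (sB x hx) (Or.inl hx')
    · exact hB x (sB x hx) (Or.inr (Or.inl hx'))
    · exact hB x (sB x hx) (Or.inr (Or.inr hx'))
    · exact absurd hx' (hWR x (sW x (sB x hx)))
  have dV2 : ∀ x, x ∈ B.support → x ∉ (q3.append A').support := by
    intro x hx hx'
    by_cases hL' : ∃ z, z ∈ W.support ∧ z ∈ I.L'.support
    · obtain ⟨z, hz, hz'⟩ := hL'
      exact h.f11 z x hz hz' (sW x hx) hx'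
    · push Not at hL'
      by_cases hM : ∃ i, i ∈ W.support ∧ i ∈ I.M.support
      · obtain ⟨i, hi, hi'⟩ := hM
        have : i ∈ W0.support := by
          rw [eW, msa] at hi
          rcases hi with hi | hi
          · exact hi
          · rw [hB i hi (Or.inr (Or.inl hi'))]; simp
        obtain ⟨X, Y, e⟩ := split this
        refine h.f9 (U1 := X) (U2 := Y.append B) (by rw [eW, e, Walk.append_assoc]) hi' (hWM i hi hi') x
          ?_ hx'
        rw [msa]; tauto
      · push Not at hM
        exact hWV (fun x hx => ⟨hM x hx, hL' x hx⟩) x (sW x hx) hx'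
  have d13 : ∀ x, x ∈ β.support → x ∉ q3.support := by
    intro x hx hx'
    exact dV2 x (sB x hx) (by rw [msa]; tauto)
  have d12 : (∀ x, x ∈ β.support → x ∉ q2.support) ∨ PBC.CommonMid β q2 := by
    have := exchange (c := c) (u := s) (v := s) eW' rfl pW p1 (q3.append A').edges.toFinset (by
      intro e he hz
      induction e using Sym2.ind with
      | _ a b =>
        rw [List.mem_toFinset] at hz
        exact dV2 a (sB a (Walk.fst_mem_support_of_mem_edges _ he)) (Walk.fst_mem_support_of_mem_edges _ hz)) (by
      intro e he hz
      induction e using Sym2.ind with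
      | _ a b =>
        rw [List.mem_toFinset] at hz
        have := Walk.fst_mem_support_of_mem_edges _ he
        exact h.dV a (by rw [msa]; tauto) (Walk.fst_mem_support_of_mem_edges _ hz))
    rcases this with h1 | h1 | ⟨W', h1, h2⟩ | ⟨V', h1, h2⟩
    · exact Or.inl h1
    · exact Or.inr h1
    · exact (IHW W' h1 h2).elim
    · exact (IHV V' h1 h2).elim
  have fin : ∃ B : PBC G s t s' t', B.IsBC := by
    by_cases hyL' : y ∈ I.L'.support ∧ y ≠ I.a
    · have hyl1 : y ∉ D.l1.support := by
        intro hy1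
        have hle : wc c D.l1 ≤ wc c A := by
          have := I.opt' ((I.L.append I.M).append I.R) (((A.append D.l2).append I.M).append I.R')
            (I.L.edges ++ I.M.edges ++ I.R.edges ++ A.edges ++ D.l2.edges ++ I.R'.edges)
            (by intro e; simp only [mea, mer, List.mem_append]; grind)
            (by intro e; simp only [mea, mer, List.mem_append]; grind)
          have e : wc c I.L' = wc c D.l1 + wc c D.l2 := by
            have := D.hL'
            rw [this, wc_append]
          have : wc c I.M = I.Cm := rfl
          simp only [lc_append, lc_edges] at *
          linarith
        have h' : BP I (wc c W) (D.l1.append q2) (q3.append A') := by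
          refine ⟨h.hκ, ?_, h.hlk, h.kM, h.lM⟩
          have := h.N
          simp only [wc_append] at *
          linarith
        exact h'.f10 (X := W0) (Y := Walk.nil) (Z := B) eW (by rw [msa]; tauto) hyL'.1
      have hyl2 : y ∈ D.l2.support := by
        have := hyL'.1
        rw [D.hL', msa] at this
        tauto
      exact D.fin34 β pβ hr hrb hyl2 (by rintro rfl; exact hyl1 (by simp)) hyL'.2 cβ hβ d13 d12
    · refine D.fin12 β pβ hr hrb ?_ cβ hβ d13 d12
      have hy2 : y ∈ I.L.support ∨ y ∈ I.M.support := by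
        by_cases hya : y = I.a
        · rw [hya]; simp
        · tauto
      rcases hy2 with h1 | h1
      · exact Or.inl h1
      · have h2 := hWM y (sW y (by simp)) h1
        exact Or.inr ⟨D.low h1 h2, by rintro rfl; exact lt_irrefl _ h2⟩
  exact I.nobc (Or.inl fin)

/-- statement of S1 for edge counts below `n` -/
def S1P (c : Sym2 V → ℝ) (G : SimpleGraph V) (n : ℕ) : Prop :=
  ∀ {s t s' t' : V} (I : Inst c G s t s' t') {k l : V} (hk : k ∈ I.M.support)
    (hl : l ∈ I.M.support) (hlk : I.C l < I.C k) (W : G.Walk s t) (V1 : G.Walk s' k)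
    (V2 : G.Walk l t'),
    (W.edges.toFinset ∪ V1.edges.toFinset ∪ V2.edges.toFinset).card < n →
    wc c I.L + I.Cm + wc c I.R + wc c I.L' + wc c I.R' ≤ wc c W + wc c V1 + wc c V2

theorem S1_step (n : ℕ) (IH : S1P c G n) : S1P c G (n+1) := by
  intro s t s' t' I k l hk hl hlk W V1 V2 hcard
  by_contra hN
  push Not at hN
  -- normalise
  obtain ⟨W, pW, V1, p1, V2, p2, hcard, hN⟩ : ∃ (W : G.Walk s t) (_ : W.IsPath) (V1 : G.Walk s' k)
      (_ : V1.IsPath) (V2 : G.Walk l t') (_ : V2.IsPath),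
      (W.edges.toFinset ∪ V1.edges.toFinset ∪ V2.edges.toFinset).card < n + 1 ∧
      wc c W + wc c V1 + wc c V2 < wc c I.L + I.Cm + wc c I.R + wc c I.L' + wc c I.R' := by
    refine ⟨W.bypass, W.bypass_isPath, V1.bypass, V1.bypass_isPath, V2.bypass, V2.bypass_isPath,
      lt_of_le_of_lt (Finset.card_le_card ?_) hcard, ?_⟩
    · intro e
      simp only [Finset.mem_union, List.mem_toFinset]
      rintro ((h | h) | h)
      · exact Or.inl (Or.inl (W.edges_bypass_subset_edges h))
      · exact Or.inl (Or.inr (V1.edges_bypass_subset_edges h))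
      · exact Or.inr (V2.edges_bypass_subset_edges h)
    · have := wc_bypass_le I.c0 W
      have := wc_bypass_le I.c0 V1
      have := wc_bypass_le I.c0 V2
      linarith
  have h0 : BP I (wc c W) V1 V2 := ⟨fun X => I.o3 W X, hN, hlk, hk, hl⟩
  obtain ⟨w, k', A, q2, X, e1, hw, c1, c2, h1⟩ := h0.shrink1
  obtain ⟨w', l', A', q3, X', e2, hw', c3, c4, h⟩ := h1.shrink2
  have p1 : (A.append q2).IsPath := by rw [e1] at p1; exact (path_append.mp p1).1
  have p2 : (q3.append A').IsPath := by rw [e2] at p2; exact (path_append.mp p2).2.1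
  have hcard : (W.edges.toFinset ∪ (A.append q2).edges.toFinset ∪
      (q3.append A').edges.toFinset).card ≤ n := by
    refine le_trans (Finset.card_le_card ?_) (Nat.lt_succ_iff.mp hcard)
    intro e
    rw [e1, e2]
    simp only [Finset.mem_union, List.mem_toFinset, mea]
    tauto
  clear e1 e2 h0 h1 hN hk hl hlk
  have IHW : ∀ W' : G.Walk s t, wc c W' ≤ wc c W →
      (W'.edges.toFinset ∪ (A.append q2).edges.toFinset ∪ (q3.append A').edges.toFinset).card <
      (W.edges.toFinset ∪ (A.append q2).edges.toFinset ∪ (q3.append A').edges.toFinset).card → False := by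
    intro W' h1 h2
    have := IH I h.kM h.lM h.hlk W' _ _ (lt_of_lt_of_le h2 hcard)
    have := h.N
    linarith
  have IHV : ∀ V' : G.Walk s' k', wc c V' ≤ wc c (A.append q2) →
      (W.edges.toFinset ∪ V'.edges.toFinset ∪ (q3.append A').edges.toFinset).card <
      (W.edges.toFinset ∪ (A.append q2).edges.toFinset ∪ (q3.append A').edges.toFinset).card → False := by
    intro W' h1 h2
    have := IH I h.kM h.lM h.hlk W W' _ (lt_of_lt_of_le h2 hcard)
    have := h.N
    linarith
  have IHV2 : ∀ V' : G.Walk l' t', wc c V' ≤ wc c (q3.append A') →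
      (W.edges.toFinset ∪ (A.append q2).edges.toFinset ∪ V'.edges.toFinset).card <
      (W.edges.toFinset ∪ (A.append q2).edges.toFinset ∪ (q3.append A').edges.toFinset).card → False := by
    intro W' h1 h2
    have := IH I h.kM h.lM h.hlk W _ W' (lt_of_lt_of_le h2 hcard)
    have := h.N
    linarith
  -- the two one-sided cases
  have left := S1_left h p1 p2 pW hw c1 c2 hw' c3 c4
  have right : (∀ x, x ∈ W.support → x ∉ I.L'.support) →
      (∀ x, x ∈ W.support → x ∈ I.M.support → I.C k' < I.C x) →
      ((∀ x, x ∈ W.support → x ∉ I.M.support ∧ x ∉ I.R'.support) →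
        ∀ x, x ∈ W.support → x ∉ (A.append q2).support) → False := by
    intro g1 g2 g3
    have hm := h.mirror
    have hr1 : (q3.append A').reverse = A'.reverse.append q3.reverse := Walk.reverse_append _ _
    have hr2 : (A.append q2).reverse = q2.reverse.append A.reverse := Walk.reverse_append _ _
    have hm : BP I.mirror (wc c W.reverse) (A'.reverse.append q3.reverse) (q2.reverse.append A.reverse) := by
      rw [hr1, hr2] at hm
      rw [wc_reverse]
      exact hm
    refine S1_left hm (by rw [← hr1]; exact p2.reverse) (by rw [← hr2]; exact p1.reverse) (by simpa using pW)
      (by simpa using hw') (by simpa using c3) (by simpa using c4) (by simpa using hw)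
      (by simpa using c1) (by simpa using c2) (by simpa using g1) ?_ ?_ ?_ ?_
    · intro x hx hx'
      simp only [msr, Inst.mirror_M] at hx hx'
      rw [I.mirror_C hx', I.mirror_C h.kM]
      have := g2 x hx hx'
      linarith
    · rw [← hr2]
      simpa only [msr, Inst.mirror_M, Inst.mirror_L'] using g3
    · intro W' h1 h2
      refine IHW W'.reverse (by simpa [wc_reverse] using h1) ?_
      rw [← hr1, ← hr2] at h2
      simp only [Walk.edges_reverse, List.toFinset_reverse] at h2 ⊢
      rw [Finset.union_right_comm] at h2
      nth_rewrite 2 [Finset.union_right_comm] at h2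
      exact h2
    · intro W' h1 h2
      refine IHV2 W'.reverse (by rw [← hr1] at h1; simpa only [wc_reverse] using h1) ?_
      rw [← hr1, ← hr2] at h2
      simp only [Walk.edges_reverse, List.toFinset_reverse] at h2 ⊢
      rw [Finset.union_right_comm] at h2
      nth_rewrite 2 [Finset.union_right_comm] at h2
      exact h2
  by_cases hL : ∃ z, z ∈ W.support ∧ z ∈ I.L'.support
  · obtain ⟨z, hz, hz'⟩ := hL
    exact left (fun x hx hx' => h.f6 z x hz hz' hx hx') (fun x hx hx' => h.f7 z x hz hz' hx hx')
      (fun hh => absurd hz' (hh z hz).2) IHW IHV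
  push Not at hL
  by_cases hR : ∃ z, z ∈ W.support ∧ z ∈ I.R'.support
  · obtain ⟨z, hz, hz'⟩ := hR
    refine right hL ?_ (fun hh => absurd hz' (hh z hz).2)
    intro x hx hx'
    have hm : BP I.mirror (wc c W.reverse) (q3.append A').reverse (A.append q2).reverse := by
      rw [wc_reverse]; exact h.mirror
    have := hm.f7 z x (by simpa using hz) (by simpa using hz') (by simpa using hx) (by simpa using hx')
    rw [I.mirror_C hx', I.mirror_C h.kM] at this
    linarith
  push Not at hR
  by_cases hlow : ∃ p, p ∈ W.support ∧ p ∈ I.M.support ∧ I.C p < I.C l'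
  · obtain ⟨p, hp, hp', hpl⟩ := hlow
    refine left hR ?_ (fun hh => absurd hp' (hh p hp).1) IHW IHV
    intro x hx hx'
    rcases h.f3 x hx hx' with h3 | h3
    · exact h3
    · exact (h.f8 p x hp hp' hx hx' hpl h3).elim
  push Not at hlow
  have hhigh : ∀ x, x ∈ W.support → x ∈ I.M.support → I.C k' < I.C x := by
    intro x hx hx'
    rcases h.f3 x hx hx' with h3 | h3
    · exact absurd h3 (not_lt.mpr (hlow x hx hx'))
    · exact h3
  by_cases hM : ∃ p, p ∈ W.support ∧ p ∈ I.M.support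
  · obtain ⟨p, hp, hp'⟩ := hM
    exact right hL hhigh (fun hh => absurd hp' (hh p hp).1)
  push Not at hM
  by_cases hV : ∃ q, q ∈ W.support ∧ q ∈ (q3.append A').support
  · obtain ⟨q, hq, hq'⟩ := hV
    exact right hL hhigh (fun _ x hx hx' => h.f5 x q hx hx' hq hq')
  · push Not at hV
    exact left hR (fun x hx hx' => absurd hx' (hM x hx)) (fun _ => hV) IHW IHV

theorem Inst.S1' (I : Inst c G s t s' t') {k l : V} (hk : k ∈ I.M.support)
    (hl : l ∈ I.M.support) (hlk : I.C l < I.C k) (W : G.Walk s t) (V1 : G.Walk s' k)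
    (V2 : G.Walk l t') :
    wc c I.L + I.Cm + wc c I.R + wc c I.L' + wc c I.R' ≤ wc c W + wc c V1 + wc c V2 := by
  have : ∀ n, S1P c G n := by
    intro n
    induction n with
    | zero => intro s t s' t' I k l _ _ _ W V1 V2 h; exact absurd h (Nat.not_lt_zero _)
    | succ n ih => exact S1_step n ih
  exact this _ I hk hl hlk W V1 V2 (Nat.lt_succ_self _)

theorem Inst.S1 (I : Inst c G s t s' t') {k l : V} (hk : k ∈ I.M.support)
    (hl : l ∈ I.M.support) (W : G.Walk s t) (V1 : G.Walk s' k) (V2 : G.Walk l t') :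
    wc c I.L + I.Cm + wc c I.R + wc c I.L' + wc c I.R' ≤
      wc c W + wc c V1 + wc c V2 + max (I.C l - I.C k) 0 := by
  rcases lt_or_ge (I.C l) (I.C k) with h | h
  · have := I.S1' hk hl h W V1 V2
    have := le_max_right (I.C l - I.C k) 0
    linarith
  · obtain ⟨X, _, _, hX⟩ := I.seg hk hl
    have := I.o3 W ((V1.append X).append V2)
    rw [abs_of_nonneg (by linarith)] at hX
    simp only [wc_append] at this
    have := le_max_left (I.C l - I.C k) 0
    linarith

end NDG
end Part10

section Part11
namespace NDG
open SimpleGraph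
variable {V : Type*} [DecidableEq V] {G : SimpleGraph V}
variable {c : Sym2 V → ℝ} {s t s' t' : V}

theorem K4_overlap (I : Inst c G s t s' t') {i j k l : V} (hi : i ∈ I.M.support)
    (hj : j ∈ I.M.support) (hk : k ∈ I.M.support) (hl : l ∈ I.M.support)
    (U1 : G.Walk s j) (U2 : G.Walk i t) (V1 : G.Walk s' k) (V2 : G.Walk l t')
    (h : max (I.C i) (I.C l) ≤ min (I.C j) (I.C k)) :
    wc c I.L + I.Cm + wc c I.R + wc c I.L' + wc c I.R' ≤ wc c U1 + wc c U2 + wc c V1 + wc c V2 := by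
  have h1 := I.o1 U1 V1 hj hk
  have h2 := I.o2 U2 V2 hi hl
  linarith

set_option maxHeartbeats 2000000 in
theorem K4_step (I : Inst c G s t s' t') {i j : V} (hi : i ∈ I.M.support)
    (hj : j ∈ I.M.support) (hij : I.C i < I.C j) (U1 : G.Walk s j) (n : ℕ) :
    ∀ {k l : V} (U2 : G.Walk i t) (V1 : G.Walk s' k) (V2 : G.Walk l t'),
    k ∈ I.M.support → l ∈ I.M.support → I.C l < I.C k → I.C j < I.C l →
    (U2.edges.toFinset ∪ V1.edges.toFinset ∪ V2.edges.toFinset).card < n →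
    wc c I.L + I.Cm + wc c I.R + wc c I.L' + wc c I.R' ≤
      wc c U1 + wc c U2 + wc c V1 + wc c V2 := by
  induction n with
  | zero => intro k l U2 V1 V2 _ _ _ _ h; exact absurd h (Nat.not_lt_zero _)
  | succ n IH =>
  intro k l U2 V1 V2 hk hl hlk hjl hcard
  by_contra hN
  push Not at hN
  obtain ⟨U2, pU, V1, p1, V2, p2, hcard, hN⟩ : ∃ (W : G.Walk i t) (_ : W.IsPath) (V1 : G.Walk s' k)
      (_ : V1.IsPath) (V2 : G.Walk l t') (_ : V2.IsPath),
      (W.edges.toFinset ∪ V1.edges.toFinset ∪ V2.edges.toFinset).card < n + 1 ∧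
      wc c U1 + wc c W + wc c V1 + wc c V2 <
        wc c I.L + I.Cm + wc c I.R + wc c I.L' + wc c I.R' := by
    refine ⟨U2.bypass, U2.bypass_isPath, V1.bypass, V1.bypass_isPath, V2.bypass, V2.bypass_isPath,
      lt_of_le_of_lt (Finset.card_le_card ?_) hcard, ?_⟩
    · intro e
      simp only [Finset.mem_union, List.mem_toFinset]
      rintro ((h | h) | h)
      · exact Or.inl (Or.inl (U2.edges_bypass_subset_edges h))
      · exact Or.inl (Or.inr (V1.edges_bypass_subset_edges h))
      · exact Or.inr (V2.edges_bypass_subset_edges h)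
    · have := wc_bypass_le I.c0 U2
      have := wc_bypass_le I.c0 V1
      have := wc_bypass_le I.c0 V2
      linarith
  have h0 : BP I (wc c U1 + wc c U2) V1 V2 := by
    refine ⟨fun X => ?_, hN, hlk, hk, hl⟩
    have := I.swap.S1' hj hi hij X U1 U2
    simp only [Inst.swap_L, Inst.swap_R, Inst.swap_L', Inst.swap_R', Inst.swap_Cm] at this
    linarith
  obtain ⟨w, k', A, q2, X, e1, hw, c1, c2, h1⟩ := h0.shrink1
  obtain ⟨w', l', A', q3, X', e2, hw', c3, c4, h⟩ := h1.shrink2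
  have p1 : (A.append q2).IsPath := by rw [e1] at p1; exact (path_append.mp p1).1
  have p2 : (q3.append A').IsPath := by rw [e2] at p2; exact (path_append.mp p2).2.1
  have hcard : (U2.edges.toFinset ∪ (A.append q2).edges.toFinset ∪
      (q3.append A').edges.toFinset).card ≤ n := by
    refine le_trans (Finset.card_le_card ?_) (Nat.lt_succ_iff.mp hcard)
    intro e
    rw [e1, e2]
    simp only [Finset.mem_union, List.mem_toFinset, mea]
    tauto
  have hk1 := h0.V1M k' (by rw [e1]; simp) h.kM
  clear e1 e2 h0 h1 hN
  have hN := h.N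
  have hjl : I.C j < I.C l' := by
    by_contra hcon
    push Not at hcon
    have hlk' := h.hlk
    have := K4_overlap I hi hj h.kM h.lM U1 U2 (A.append q2) (q3.append A')
      (max_le (le_min (by linarith) (by linarith)) (le_min hcon h.hlk.le))
    linarith
  have hlk := h.hlk
  have hs : BP I.swap (wc c (A.append q2) + wc c (q3.append A')) U1 U2 := by
    refine ⟨fun X => ?_, ?_, hij, hj, hi⟩
    · have := I.S1' h.kM h.lM h.hlk X (A.append q2) (q3.append A')
      simp only [Inst.swap_L, Inst.swap_R, Inst.swap_L', Inst.swap_R', Inst.swap_Cm]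
      linarith
    · simp only [Inst.swap_L, Inst.swap_R, Inst.swap_L', Inst.swap_R', Inst.swap_Cm]
      linarith
  have uR' : ∀ x, x ∈ U2.support → x ∉ I.R'.support := hs.V2R
  have uL' : ∀ x, x ∈ U2.support → x ∉ I.L'.support := hs.V2L
  have uL : ∀ x, x ∈ U2.support → x ∉ I.L.support := hs.V2L'
  have uM : ∀ x, x ∈ U2.support → x ∈ I.M.support → I.C x < I.C j := hs.V2M
  have dV2 : ∀ x, x ∈ U2.support → x ∉ (q3.append A').support := by
    intro p hp hp'
    obtain ⟨X, Y, eU⟩ := split hp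
    obtain ⟨D1, D2, eV⟩ := split hp'
    obtain ⟨K1, K2, e', h1, h2, h3, h4⟩ := I.pre hi
    have h5 := I.opt' ((I.L.append K1).append U2) (((I.L'.append K1).append X).append D2)
        (I.L.edges ++ I.L'.edges ++ K1.edges ++ U2.edges ++ (q3.append A').edges)
        (by intro e; simp only [mea, mer, List.mem_append]; grind)
        (by intro e; rw [eU, eV]; simp only [mea, mer, List.mem_append]; grind)
    have h6 := I.o1 U1 (A.append q2) hj h.kM
    rw [min_eq_left (by linarith)] at h6
    simp only [lc_append, lc_edges, wc_append, wc_reverse] at *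
    linarith
  obtain ⟨D⟩ := h.raw p1 p2 hw c1 c2 hw' c3 c4
  obtain ⟨y, W0, B, eW, hy, hB⟩ := last_hit (fun x => x ∈ I.M.support) U2 ⟨i, by simp, hi⟩
  obtain ⟨r, β, W1, eB, hr, hβ⟩ := first_hit (fun x => x ∈ I.R.support) B ⟨t, by simp, by simp⟩
  have sB : ∀ x, x ∈ β.support → x ∈ B.support := by
    intro x hx; rw [eB, msa]; tauto
  have sW : ∀ x, x ∈ B.support → x ∈ U2.support := by
    intro x hx; rw [eW, msa]; tauto
  have eW' : U2 = (W0.append β).append W1 := by rw [eW, eB, Walk.append_assoc]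
  have pβ : β.IsPath := by
    rw [eW'] at pU
    exact (path_append.mp (path_append.mp pU).1).2.1
  have hrb : r ≠ I.b := by
    rintro rfl
    have := uM I.b (sW _ (sB _ (by simp))) (by simp)
    rw [I.C_b] at this
    have := I.C_le hj
    linarith
  have cβ : ∀ x, x ∈ β.support → x ∈ I.L.support ∨ x ∈ I.M.support ∨ x ∈ I.L'.support ∨
      x ∈ I.R'.support → x = y := by
    intro x hx hx'
    have hx2 := sW x (sB x hx)
    rcases hx' with hx' | hx' | hx' | hx'
    · exact absurd hx' (uL x hx2)
    · exact hB x (sB x hx) hx'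
    · exact absurd hx' (uL' x hx2)
    · exact absurd hx' (uR' x hx2)
  have d13 : ∀ x, x ∈ β.support → x ∉ q3.support := by
    intro x hx hx'
    exact dV2 x (sW x (sB x hx)) (by rw [msa]; tauto)
  have d12 : (∀ x, x ∈ β.support → x ∉ q2.support) ∨ PBC.CommonMid β q2 := by
    have := exchange (c := c) (u := s) (v := s) eW' rfl pU p1 (q3.append A').edges.toFinset (by
      intro e he hz
      induction e using Sym2.ind with
      | _ a b =>
        rw [List.mem_toFinset] at hz
        exact dV2 a (sW _ (sB a (Walk.fst_mem_support_of_mem_edges _ he)))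
          (Walk.fst_mem_support_of_mem_edges _ hz)) (by
      intro e he hz
      induction e using Sym2.ind with
      | _ a b =>
        rw [List.mem_toFinset] at hz
        have := Walk.fst_mem_support_of_mem_edges _ he
        exact h.dV a (by rw [msa]; tauto) (Walk.fst_mem_support_of_mem_edges _ hz))
    rcases this with h1 | h1 | ⟨W', h1, h2⟩ | ⟨V', h1, h2⟩
    · exact Or.inl h1
    · exact Or.inr h1
    · have := IH W' (A.append q2) (q3.append A') h.kM h.lM h.hlk hjl (lt_of_lt_of_le h2 hcard)
      linarith
    · have := IH U2 V' (q3.append A') h.kM h.lM h.hlk hjl (lt_of_lt_of_le h2 hcard)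
      linarith
  have hyC := uM y (sW y (by simp)) hy
  have fin : ∃ B : PBC G s t s' t', B.IsBC :=
    D.fin12 β pβ hr hrb (Or.inr ⟨D.low hy (by linarith), by rintro rfl; linarith⟩) cβ hβ d13 d12
  exact I.nobc (Or.inl fin)

theorem Inst.K4 (I : Inst c G s t s' t') {i j k l : V} (hi : i ∈ I.M.support)
    (hj : j ∈ I.M.support) (hk : k ∈ I.M.support) (hl : l ∈ I.M.support)
    (U1 : G.Walk s j) (U2 : G.Walk i t) (V1 : G.Walk s' k) (V2 : G.Walk l t')
    (hij : I.C i < I.C j) (hlk : I.C l < I.C k) :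
    wc c I.L + I.Cm + wc c I.R + wc c I.L' + wc c I.R' ≤
      wc c U1 + wc c U2 + wc c V1 + wc c V2 := by
  by_cases h1 : I.C j < I.C l
  · exact K4_step I hi hj hij U1 _ U2 V1 V2 hk hl hlk h1 (Nat.lt_succ_self _)
  by_cases h2 : I.C k < I.C i
  · have := K4_step I.swap hl hk hlk V1 _ V2 U1 U2 hj hi hij h2 (Nat.lt_succ_self _)
    simp only [Inst.swap_L, Inst.swap_R, Inst.swap_L', Inst.swap_R', Inst.swap_Cm] at this
    linarith
  push Not at h1 h2
  exact K4_overlap I hi hj hk hl U1 U2 V1 V2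
    (max_le (le_min hij.le h2) (le_min h1 hlk.le))

theorem Inst.K (I : Inst c G s t s' t') {i j k l : V} (hi : i ∈ I.M.support)
    (hj : j ∈ I.M.support) (hk : k ∈ I.M.support) (hl : l ∈ I.M.support)
    (U1 : G.Walk s j) (U2 : G.Walk i t) (V1 : G.Walk s' k) (V2 : G.Walk l t') :
    wc c I.L + I.Cm + wc c I.R + wc c I.L' + wc c I.R' ≤
      wc c U1 + wc c U2 + max (I.C i - I.C j) 0 + wc c V1 + wc c V2 + max (I.C l - I.C k) 0 := by
  have m1 := le_max_right (I.C i - I.C j) 0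
  have m2 := le_max_right (I.C l - I.C k) 0
  rcases lt_or_ge (I.C i) (I.C j) with h | h
  · rcases lt_or_ge (I.C l) (I.C k) with h' | h'
    · have := I.K4 hi hj hk hl U1 U2 V1 V2 h h'
      linarith
    · obtain ⟨X, _, _, hX⟩ := I.seg hk hl
      rw [abs_of_nonneg (by linarith)] at hX
      have := I.swap.S1 hj hi ((V1.append X).append V2) U1 U2
      simp only [Inst.swap_L, Inst.swap_R, Inst.swap_L', Inst.swap_R', Inst.swap_Cm, Inst.swap_C,
        wc_append] at this
      have := le_max_left (I.C l - I.C k) 0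
      linarith
  · obtain ⟨X, _, _, hX⟩ := I.seg hj hi
    rw [abs_of_nonneg (by linarith)] at hX
    have := I.S1 hk hl ((U1.append X).append U2) V1 V2
    simp only [wc_append] at this
    have := le_max_left (I.C i - I.C j) 0
    linarith

end NDG
end Part11

section Part12
namespace NDG
open SimpleGraph
variable {V : Type*} [DecidableEq V] {G : SimpleGraph V}
variable {c : Sym2 V → ℝ} {s t s' t' : V}

theorem wc_path {x y : V} (p : G.Walk x y) (hp : p.IsPath) :
    wc c p = ∑ e ∈ p.edges.toFinset, c e := by
  rw [List.sum_toFinset _ hp.isTrail.edges_nodup]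
  rfl

theorem shortest [Finite V] (c0 : ∀ e, 0 ≤ c e) {x y : V} (h : Nonempty (G.Walk x y)) :
    ∃ p : G.Walk x y, ∀ q : G.Walk x y, wc c p ≤ wc c q := by
  obtain ⟨p0⟩ := h
  have fin : Set.Finite {z : ℝ | ∃ p : G.Walk x y, p.IsPath ∧ wc c p = z} := by
    refine Set.Finite.subset (Set.finite_range (fun S : Finset (Sym2 V) => ∑ e ∈ S, c e)) ?_
    rintro z ⟨p, hp, rfl⟩
    exact ⟨p.edges.toFinset, (wc_path p hp).symm⟩
  obtain ⟨z, ⟨p, hp, rfl⟩, hz⟩ := Set.exists_min_image _ id fin ⟨_, p0.bypass, p0.bypass_isPath, rfl⟩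
  refine ⟨p, fun q => ?_⟩
  exact (hz _ ⟨q.bypass, q.bypass_isPath, rfl⟩).trans (wc_bypass_le c0 q)

theorem exists_dist [Finite V] (c0 : ∀ e, 0 ≤ c e) : ∃ d : V → V → ℝ,
    (∀ {x y : V} (q : G.Walk x y), d x y ≤ wc c q) ∧
    (∀ {x y : V} (q : G.Walk x y), ∃ p : G.Walk x y, wc c p = d x y) := by
  classical
  refine ⟨fun x y => if h : Nonempty (G.Walk x y) then wc c (shortest c0 h).choose else 0, ?_, ?_⟩
  · intro x y q
    have h : Nonempty (G.Walk x y) := ⟨q⟩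
    simp only [dif_pos h]
    exact (shortest c0 h).choose_spec q
  · intro x y q
    have h : Nonempty (G.Walk x y) := ⟨q⟩
    simp only [dif_pos h]
    exact ⟨_, rfl⟩

/-- monotone 1-Lipschitz interpolation -/
theorem interp (S : Finset V) (hS : S.Nonempty) (C lo hi : V → ℝ)
    (h : ∀ p ∈ S, ∀ q ∈ S, lo q - max (C q - C p) 0 ≤ hi p) :
    ∃ x : V → ℝ, (∀ p ∈ S, lo p ≤ x p) ∧ (∀ p ∈ S, x p ≤ hi p) ∧
      (∀ p q, C p ≤ C q → x p ≤ x q ∧ x q - x p ≤ C q - C p) := by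
  refine ⟨fun p => S.sup' hS (fun q => lo q - max (C q - C p) 0), ?_, ?_, ?_⟩
  · intro p hp
    have := Finset.le_sup' (fun q => lo q - max (C q - C p) 0) hp
    rw [sub_self, max_self, sub_zero] at this
    exact this
  · intro p hp
    apply Finset.sup'_le
    intro q hq
    exact h p hp q hq
  · intro p q hpq
    constructor
    · apply Finset.sup'_le
      intro z hz
      refine le_trans ?_ (Finset.le_sup' (fun z => lo z - max (C z - C q) 0) hz)
      have : max (C z - C q) 0 ≤ max (C z - C p) 0 := max_le_max (by linarith) le_rfl
      linarith
    · rw [sub_le_iff_le_add]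
      apply Finset.sup'_le
      intro z hz
      have := Finset.le_sup' (fun z => lo z - max (C z - C p) 0) hz
      have h2 : max (C z - C p) 0 ≤ max (C z - C q) 0 + (C q - C p) :=
        max_le (by have := le_max_left (C z - C q) 0; linarith)
          (by have := le_max_right (C z - C q) 0; linarith)
      linarith

theorem lp (S : Finset V) (hS : S.Nonempty) (C u r u' r' : V → ℝ) (f f' Cm : ℝ) (a b : V)
    (ha : a ∈ S) (hb : b ∈ S) (Ca : C a = 0) (Cb : C b = Cm)
    (ua : u a = 0) (rb : r b = 0) (ua' : u' a = 0) (rb' : r' b = 0)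
    (I1 : ∀ i ∈ S, ∀ j ∈ S, ∀ k ∈ S, ∀ l ∈ S,
      Cm ≤ u j + r i + max (C i - C j) 0 + u' k + r' l + max (C l - C k) 0)
    (I2 : ∀ k ∈ S, ∀ l ∈ S, Cm ≤ f + u' k + r' l + max (C l - C k) 0)
    (I3 : ∀ i ∈ S, ∀ j ∈ S, Cm ≤ f' + u j + r i + max (C i - C j) 0)
    (I4 : Cm ≤ f + f')
    (m1 : ∀ p ∈ S, ∀ q ∈ S, min (C p) (C q) ≤ u p + u' q)
    (m2 : ∀ p ∈ S, ∀ q ∈ S, Cm - max (C p) (C q) ≤ r q + r' p) :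
    ∃ (x : V → ℝ) (T : ℝ), x a = 0 ∧ x b = T ∧ T ≤ f ∧ Cm - T ≤ f' ∧
      (∀ p ∈ S, x p ≤ u p) ∧ (∀ p ∈ S, T - x p ≤ r p) ∧
      (∀ p ∈ S, C p - x p ≤ u' p) ∧ (∀ p ∈ S, (Cm - T) - (C p - x p) ≤ r' p) ∧
      (∀ p q, C p ≤ C q → x p ≤ x q ∧ x q - x p ≤ C q - C p) := by
  let T0 : ℝ := (S ×ˢ S).inf' (hS.product hS) (fun z => u z.1 + r z.2 + max (C z.2 - C z.1) 0)
  let T := min f T0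
  have T1 : ∀ j ∈ S, ∀ i ∈ S, T ≤ u j + r i + max (C i - C j) 0 := by
    intro j hj i hi
    refine (min_le_right _ _).trans ?_
    exact Finset.inf'_le (fun z : V × V => u z.1 + r z.2 + max (C z.2 - C z.1) 0)
      (b := (j, i)) (Finset.mem_product.mpr ⟨hj, hi⟩)
  have T2 : ∀ k ∈ S, ∀ l ∈ S, Cm - u' k - r' l - max (C l - C k) 0 ≤ T := by
    intro k hk l hl
    refine le_min ?_ ?_
    · have := I2 k hk l hl
      linarith
    · apply Finset.le_inf'
      rintro ⟨j, i⟩ hz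
      have hz := Finset.mem_product.mp hz
      have := I1 i hz.2 j hz.1 k hk l hl
      simp only
      linarith
  have T3 : Cm - f' ≤ T := by
    refine le_min (by linarith) ?_
    apply Finset.le_inf'
    rintro ⟨j, i⟩ hz
    have hz := Finset.mem_product.mp hz
    have := I3 i hz.2 j hz.1
    simp only
    linarith
  obtain ⟨x, x1, x2, x3⟩ := interp S hS C (fun q => max (T - r q) (C q - u' q))
    (fun p => min (u p) (r' p + T - (Cm - C p))) (by
      intro p hp q hq
      have g1 := T1 p hp q hq
      have g2 := m1 p hp q hq
      have g3 := m2 p hp q hq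
      have g4 := T2 q hq p hp
      rw [sub_le_iff_le_add]
      apply max_le <;> rw [← sub_le_iff_le_add] <;> apply le_min
      · linarith
      · rcases le_total (C p) (C q) with h | h
        · rw [max_eq_left (by linarith)]; rw [max_eq_right h] at g3; linarith
        · rw [max_eq_right (by linarith)]; rw [max_eq_left h] at g3; linarith
      · rcases le_total (C p) (C q) with h | h
        · rw [max_eq_left (by linarith)]; rw [min_eq_left h] at g2; linarith
        · rw [max_eq_right (by linarith)]; rw [min_eq_right h] at g2; linarith
      · rcases le_total (C p) (C q) with h | h
        · rw [max_eq_left (by linarith)]; rw [max_eq_right (by linarith)] at g4; linarith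
        · rw [max_eq_right (by linarith)]; rw [max_eq_left (by linarith)] at g4; linarith)
  have y1 := fun p hp => (max_le_iff.mp (x1 p hp))
  have y2 := fun p hp => (le_min_iff.mp (x2 p hp))
  refine ⟨x, T, ?_, ?_, min_le_left _ _, by linarith, fun p hp => (y2 p hp).1, ?_, ?_, ?_, x3⟩
  · have := (y1 a ha).2
    have := (y2 a ha).1
    linarith
  · have := (y1 b hb).1
    have := (y2 b hb).2
    linarith
  · intro p hp
    have := (y1 p hp).1
    linarith
  · intro p hp
    have := (y1 p hp).2
    linarith
  · intro p hp
    have := (y2 p hp).2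
    linarith

theorem edge_split {x y v w : V} (p : G.Walk x y) (h : s(v, w) ∈ p.edges) :
    (∃ (A : G.Walk x v) (e : G.Adj v w) (B : G.Walk w y), p = A.append (Walk.cons e B)) ∨
    (∃ (A : G.Walk x w) (e : G.Adj w v) (B : G.Walk v y), p = A.append (Walk.cons e B)) := by
  induction p with
  | nil => simp at h
  | @cons a b d hadj K ih =>
    rw [Walk.edges_cons, List.mem_cons] at h
    rcases h with h | h
    · rw [Sym2.eq_iff] at h
      rcases h with ⟨rfl, rfl⟩ | ⟨rfl, rfl⟩
      · left; exact ⟨Walk.nil, hadj, K, rfl⟩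
      · right; exact ⟨Walk.nil, hadj, K, rfl⟩
    · rcases ih h with ⟨A, e, B, rfl⟩ | ⟨A, e, B, rfl⟩
      · left; exact ⟨Walk.cons hadj A, e, B, rfl⟩
      · right; exact ⟨Walk.cons hadj A, e, B, rfl⟩

theorem Inst.C_edge (I : Inst c G s t s' t') {v w : V} (h : s(v, w) ∈ I.M.edges) :
    |I.C v - I.C w| = c s(v, w) := by
  have key : ∀ {v w : V}, (∃ (A : G.Walk I.a v) (e : G.Adj v w) (B : G.Walk w I.b),
      I.M = A.append (Walk.cons e B)) → |I.C v - I.C w| = c s(v, w) := by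
    rintro v w ⟨A, e, B, hM⟩
    have := I.ord_C (K1 := A) (X := Walk.cons e Walk.nil) (K2 := B) (by
      rw [hM, ← Walk.append_assoc]; rfl)
    have h2 : wc c (Walk.cons e (Walk.nil : G.Walk w w)) = c s(v, w) := by
      rw [wc_cons, wc_nil, add_zero]
    rw [abs_sub_comm, abs_of_nonneg (by linarith), ← this.2.1, h2]
  rcases edge_split I.M h with h1 | h1
  · exact key h1
  · rw [abs_sub_comm, Sym2.eq_swap]
    exact key h1

/-- price bound for one player from a potential along the common segment -/
theorem price_bound (I : Inst c G s t s' t') (π : Sym2 V → ℝ) (x : V → ℝ) (T : ℝ)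
    (h1 : ∀ p ∈ I.M.support, ∀ U : G.Walk s p, wc c I.L + x p ≤ wc c U)
    (h2 : ∀ p ∈ I.M.support, ∀ U : G.Walk p t, wc c I.R + T - x p ≤ wc c U)
    (h3 : ∀ W : G.Walk s t, wc c I.L + T + wc c I.R ≤ wc c W)
    (hx : ∀ p q, I.C p ≤ I.C q → x p ≤ x q ∧ x q - x p ≤ I.C q - I.C p)
    (hxa : x I.a = 0) (hxb : x I.b = T)
    (h5 : ∀ v w, s(v, w) ∈ I.M.edges → π s(v, w) = |x v - x w|)
    (h6 : ∀ e, e ∉ I.M.edges → π e = c e) (Q : G.Walk s t) :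
    wc π ((I.L.append I.M).append I.R) ≤ wc π Q := by
  have h4 : ∀ p ∈ I.M.support, ∀ q ∈ I.M.support, ∀ U : G.Walk p q, x q - x p ≤ wc c U := by
    intro p hp q hq U
    have hb := I.b_M' U hp hq
    have := wc_nonneg I.c0 U
    rcases le_total (I.C p) (I.C q) with h | h
    · have := (hx p q h).2
      linarith
    · have := (hx q p h).1
      linarith
  have low : ∀ {y z : V} (Q : G.Walk y z), (hz : z = t) →
      (∀ p ∈ I.M.support, ∀ Q0 : G.Walk p y, wc c I.R + T - x p ≤ wc c Q0 + wc π Q) ∧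
      (∀ Q0 : G.Walk s y, wc c I.L + T + wc c I.R ≤ wc c Q0 + wc π Q) := by
    intro y z Q
    induction Q with
    | nil =>
      rintro rfl
      refine ⟨fun p hp Q0 => ?_, fun Q0 => ?_⟩
      · rw [wc_nil, add_zero]; exact h2 p hp Q0
      · rw [wc_nil, add_zero]; exact h3 Q0
    | @cons y y' z hadj Q ih =>
      intro hz
      obtain ⟨ih1, ih2⟩ := ih hz
      by_cases he : s(y, y') ∈ I.M.edges
      · have hy := Walk.fst_mem_support_of_mem_edges _ he
        have hy' := Walk.snd_mem_support_of_mem_edges _ he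
        have e1 := h5 y y' he
        have e2 := neg_abs_le (x y - x y')
        have e3 := ih1 y' hy' Walk.nil
        rw [wc_nil] at e3
        refine ⟨fun p hp Q0 => ?_, fun Q0 => ?_⟩
        · have := h4 p hp y hy Q0
          rw [wc_cons]
          linarith
        · have := h1 y hy Q0
          rw [wc_cons]
          linarith
      · have e1 := h6 _ he
        refine ⟨fun p hp Q0 => ?_, fun Q0 => ?_⟩
        · have := ih1 p hp (Q0.append (Walk.cons hadj Walk.nil))
          rw [wc_append, wc_cons, wc_nil] at this
          rw [wc_cons]
          linarith
        · have := ih2 (Q0.append (Walk.cons hadj Walk.nil))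
          rw [wc_append, wc_cons, wc_nil] at this
          rw [wc_cons]
          linarith
  have suf : ∀ {p z : V} (K2 : G.Walk p z) (hz : z = I.b),
      (∃ K1 : G.Walk I.a p, I.M.copy rfl hz.symm = K1.append K2) → wc π K2 = x I.b - x p := by
    intro p z K2
    induction K2 with
    | nil => rintro rfl _; simp [wc_nil]
    | @cons y y' z hadj Q ih =>
      rintro rfl ⟨K1, hM⟩
      simp only [Walk.copy_rfl_rfl] at hM
      have hM' : I.M = (K1.append (Walk.cons hadj Walk.nil)).append Q := by
        rw [hM, ← Walk.append_assoc]; rfl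
      have hC := (I.ord_C hM').2.2.2
      have e1 := h5 y y' (by rw [hM]; simp)
      have e2 := ih rfl ⟨K1.append (Walk.cons hadj Walk.nil), hM'⟩
      rw [wc_cons, e1, e2, abs_of_nonpos (by have := (hx _ _ hC).1; linarith)]
      ring
  have eM : wc π I.M = T := by
    rw [suf I.M rfl ⟨Walk.nil, rfl⟩, hxa, hxb, sub_zero]
  have same : ∀ {y z : V} (X : G.Walk y z), (∀ e ∈ X.edges, e ∉ I.M.edges) → wc π X = wc c X := by
    intro y z X hX
    unfold wc lc
    rw [List.map_congr_left (fun e he => h6 e (hX e he))]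
  have pA := path_append.mp I.hA
  have eL : wc π I.L = wc c I.L := same _ (fun e he => edges_disj pA.1 he)
  have eR : wc π I.R = wc c I.R := same _ (fun e he he' => edges_disj I.hA (by rw [mea]; exact Or.inr he') he)
  have := (low Q rfl).2 Walk.nil
  rw [wc_nil, zero_add] at this
  rw [wc_append, wc_append, eM, eL, eR]
  exact this

end NDG
end Part12

section Part13
namespace NDG
open SimpleGraph
variable {V : Type*} [DecidableEq V] {G : SimpleGraph V}
variable {c : Sym2 V → ℝ} {s t s' t' : V}

theorem core [Finite V] (I : Inst c G s t s' t') : ∃ ξ : Sym2 V → ℝ,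
    (∀ e ∈ I.M.edges, 0 ≤ ξ e ∧ ξ e ≤ c e) ∧
    (∀ Q : G.Walk s t, wc (fun e => if e ∈ I.M.edges then ξ e else c e)
        ((I.L.append I.M).append I.R) ≤
      wc (fun e => if e ∈ I.M.edges then ξ e else c e) Q) ∧
    (∀ Q : G.Walk s' t', wc (fun e => if e ∈ I.M.edges then c e - ξ e else c e)
        ((I.L'.append I.M).append I.R') ≤
      wc (fun e => if e ∈ I.M.edges then c e - ξ e else c e) Q) := by
  obtain ⟨d, d1, d2⟩ := exists_dist (G := G) I.c0
  have ws : ∀ p ∈ I.M.support, ∃ U : G.Walk s p, wc c U = d s p := by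
    intro p hp
    obtain ⟨K1, K2, _⟩ := I.pre hp
    exact d2 (I.L.append K1)
  have ws' : ∀ p ∈ I.M.support, ∃ U : G.Walk s' p, wc c U = d s' p := by
    intro p hp
    obtain ⟨K1, K2, _⟩ := I.pre hp
    exact d2 (I.L'.append K1)
  have wt : ∀ p ∈ I.M.support, ∃ U : G.Walk p t, wc c U = d p t := by
    intro p hp
    obtain ⟨K1, K2, _⟩ := I.pre hp
    exact d2 (K2.append I.R)
  have wt' : ∀ p ∈ I.M.support, ∃ U : G.Walk p t', wc c U = d p t' := by
    intro p hp
    obtain ⟨K1, K2, _⟩ := I.pre hp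
    exact d2 (K2.append I.R')
  have wst : ∃ W : G.Walk s t, wc c W = d s t := d2 ((I.L.append I.M).append I.R)
  have wst' : ∃ W : G.Walk s' t', wc c W = d s' t' := d2 ((I.L'.append I.M).append I.R')
  obtain ⟨x, T, xa, xb, Tf, Tf', h1, h2, h3, h4, hx⟩ := lp I.M.support.toFinset ⟨I.a, by simp⟩ I.C
    (fun p => d s p - wc c I.L) (fun p => d p t - wc c I.R)
    (fun p => d s' p - wc c I.L') (fun p => d p t' - wc c I.R')
    (d s t - wc c I.L - wc c I.R) (d s' t' - wc c I.L' - wc c I.R') I.Cm I.a I.b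
    (by simp) (by simp) I.C_a I.C_b
    (by
      obtain ⟨U, hU⟩ := ws I.a (by simp)
      have := I.b_s U (by simp)
      have := d1 I.L
      linarith)
    (by
      obtain ⟨U, hU⟩ := wt I.b (by simp)
      have := I.b_t U (by simp)
      have := d1 I.R
      linarith)
    (by
      obtain ⟨U, hU⟩ := ws' I.a (by simp)
      have := I.b_s' U (by simp)
      have := d1 I.L'
      linarith)
    (by
      obtain ⟨U, hU⟩ := wt' I.b (by simp)
      have := I.b_t' U (by simp)
      have := d1 I.R'
      linarith)
    (by
      intro i hi j hj k hk l hl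
      rw [List.mem_toFinset] at hi hj hk hl
      obtain ⟨U1, e1⟩ := ws j hj
      obtain ⟨U2, e2⟩ := wt i hi
      obtain ⟨V1, e3⟩ := ws' k hk
      obtain ⟨V2, e4⟩ := wt' l hl
      have := I.K hi hj hk hl U1 U2 V1 V2
      linarith)
    (by
      intro k hk l hl
      rw [List.mem_toFinset] at hk hl
      obtain ⟨W, e1⟩ := wst
      obtain ⟨V1, e3⟩ := ws' k hk
      obtain ⟨V2, e4⟩ := wt' l hl
      have := I.S1 hk hl W V1 V2
      linarith)
    (by
      intro i hi j hj
      rw [List.mem_toFinset] at hi hj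
      obtain ⟨W, e1⟩ := wst'
      obtain ⟨U1, e3⟩ := ws j hj
      obtain ⟨U2, e4⟩ := wt i hi
      have := I.swap.S1 hj hi W U1 U2
      simp only [Inst.swap_L, Inst.swap_R, Inst.swap_L', Inst.swap_R', Inst.swap_Cm, Inst.swap_C] at this
      linarith)
    (by
      obtain ⟨W, e1⟩ := wst
      obtain ⟨W', e2⟩ := wst'
      have := I.o3 W W'
      linarith)
    (by
      intro p hp q hq
      rw [List.mem_toFinset] at hp hq
      obtain ⟨U1, e1⟩ := ws p hp
      obtain ⟨V1, e2⟩ := ws' q hq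
      have := I.o1 U1 V1 hp hq
      linarith)
    (by
      intro p hp q hq
      rw [List.mem_toFinset] at hp hq
      obtain ⟨U1, e1⟩ := wt q hq
      obtain ⟨V1, e2⟩ := wt' p hp
      have := I.o2 U1 V1 hq hp
      rw [max_comm]
      linarith)
  simp only [List.mem_toFinset] at h1 h2 h3 h4
  have hy : ∀ p q, I.C p ≤ I.C q → I.C p - x p ≤ I.C q - x q ∧
      (I.C q - x q) - (I.C p - x p) ≤ I.C q - I.C p := by
    intro p q h
    have := hx p q h
    constructor <;> linarith
  let ξ : Sym2 V → ℝ := Sym2.lift ⟨fun v w => |x v - x w|, fun v w => abs_sub_comm _ _⟩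
  have hξ : ∀ v w, ξ s(v, w) = |x v - x w| := fun v w => rfl
  have hξ2 : ∀ v w, s(v, w) ∈ I.M.edges → c s(v, w) - ξ s(v, w) =
      |(I.C v - x v) - (I.C w - x w)| := by
    intro v w he
    rw [← I.C_edge he, hξ]
    rcases le_total (I.C v) (I.C w) with h | h
    · have h1 := hx v w h
      rw [abs_of_nonpos (by linarith), abs_of_nonpos (by linarith), abs_of_nonpos (by linarith)]
      ring
    · have h1 := hx w v h
      rw [abs_of_nonneg (by linarith), abs_of_nonneg (by linarith), abs_of_nonneg (by linarith)]
      ring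
  refine ⟨ξ, ?_, ?_, ?_⟩
  · intro e
    induction e using Sym2.ind with
    | _ v w =>
      intro he
      have := hξ2 v w he
      have h8 := abs_nonneg ((I.C v - x v) - (I.C w - x w))
      exact ⟨abs_nonneg _, by linarith⟩
  · intro Q
    refine price_bound I _ x T ?_ ?_ ?_ hx xa xb ?_ ?_ Q
    · intro p hp U
      have := h1 p hp
      have := d1 U
      linarith
    · intro p hp U
      have := h2 p hp
      have := d1 U
      linarith
    · intro W
      have := d1 W
      linarith
    · intro v w he
      simp only [if_pos he]
      exact hξ v w
    · intro e he
      simp only [if_neg he]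
  · intro Q
    refine price_bound I.swap _ (fun p => I.C p - x p) (I.Cm - T) ?_ ?_ ?_ hy ?_ ?_ ?_ ?_ Q
    · intro p hp U
      have := h3 p hp
      have := d1 U
      simp only [Inst.swap_L]
      linarith
    · intro p hp U
      have := h4 p hp
      have := d1 U
      simp only [Inst.swap_R]
      linarith
    · intro W
      have := d1 W
      simp only [Inst.swap_L, Inst.swap_R]
      linarith
    · simp only [Inst.swap_a, I.C_a, xa, sub_zero]
    · simp only [Inst.swap_b, I.C_b, xb]
    · intro v w he
      have he' : s(v, w) ∈ I.M.edges := he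
      simp only [if_pos he']
      exact hξ2 v w he
    · intro e he
      have he' : e ∉ I.M.edges := he
      simp only [if_neg he']

end NDG
end Part13

section Part14
namespace NDG
open SimpleGraph
variable {V : Type*} [DecidableEq V] {G : SimpleGraph V}
variable {c : Sym2 V → ℝ} {s t s' t' : V}

theorem walk_into {H : SimpleGraph V} {S : Set (Sym2 V)} (hH : H.edgeSet ⊆ S) (hG : H ≤ G)
    {x y : V} (h : H.Reachable x y) :
    ∃ p : G.Walk x y, p.IsPath ∧ ∀ e ∈ p.edges, e ∈ S := by
  obtain ⟨p⟩ := h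
  refine ⟨(p.mapLe hG).bypass, Walk.bypass_isPath _, ?_⟩
  intro e he
  have h1 := Walk.edges_bypass_subset_edges _ he
  rw [Walk.edges_mapLe_eq_edges] at h1
  exact hH (p.edges_subset_edgeSet h1)

theorem reach_of_walk {S : Set (Sym2 V)} {x y : V} (p : G.Walk x y) (h : ∀ e ∈ p.edges, e ∈ S) :
    (fromEdgeSet S).Reachable x y := by
  refine ⟨p.transfer _ ?_⟩
  intro e he
  rw [edgeSet_fromEdgeSet]
  exact ⟨h e he, fun hd => G.not_isDiag_of_mem_edgeSet (p.edges_subset_edgeSet he) hd⟩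

theorem opt_le [Finite V] (c0 : ∀ e, 0 ≤ c e) {F : Finset (Sym2 V)}
    (hF : IsOptimalSteinerForest G s t s' t' c F) (P : G.Walk s t) (Q : G.Walk s' t')
    (E : List (Sym2 V)) (hP : P.edges ⊆ E) (hQ : Q.edges ⊆ E) : cost c F ≤ lc c E := by
  obtain ⟨F0, hle, hac, hr⟩ := SimpleGraph.exists_isAcyclic_reachable_eq_le
    (G := fromEdgeSet {e | e ∈ P.edges ∨ e ∈ Q.edges})
  have hHG : fromEdgeSet {e | e ∈ P.edges ∨ e ∈ Q.edges} ≤ G := by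
    intro x y hxy
    rw [fromEdgeSet_adj] at hxy
    rcases hxy.1 with h | h
    · exact P.edges_subset_edgeSet h
    · exact Q.edges_subset_edgeSet h
  let F' := (Set.toFinite F0.edgeSet).toFinset
  have hF' : ∀ e, e ∈ F' ↔ e ∈ F0.edgeSet := fun e => by simp [F']
  have hS : IsSteinerForest G s t s' t' F' := by
    refine ⟨?_, ?_, ?_, ?_⟩
    · intro e he
      exact edgeSet_mono (hle.trans hHG) ((hF' e).1 he)
    · have : (↑F' : Set (Sym2 V)) = F0.edgeSet := by ext e; exact hF' e
      rw [this, fromEdgeSet_edgeSet]; exact hac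
    · apply walk_into (H := F0) (S := {e | e ∈ F'}) (fun e he => (hF' e).2 he) (hle.trans hHG)
      rw [hr]; exact reach_of_walk P (fun e he => Or.inl he)
    · apply walk_into (H := F0) (S := {e | e ∈ F'}) (fun e he => (hF' e).2 he) (hle.trans hHG)
      rw [hr]; exact reach_of_walk Q (fun e he => Or.inr he)
  refine (hF.2 F' hS).trans ?_
  have h1 : cost c F' = lc c F'.toList := by
    unfold cost lc; exact (Finset.sum_map_toList F' c).symm
  rw [h1]
  refine lc_sub_nodup c0 (Finset.nodup_toList F') ?_
  intro e he
  rw [Finset.mem_toList, hF'] at he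
  have h2 := edgeSet_mono hle he
  rw [edgeSet_fromEdgeSet] at h2
  rcases h2.1 with h | h
  · exact hP h
  · exact hQ h

def Prices (c : Sym2 V → ℝ) (P1 : G.Walk s t) (P2 : G.Walk s' t') : Prop :=
  ∃ ξ : Sym2 V → ℝ, (∀ e ∈ P1.edges, e ∈ P2.edges → 0 ≤ ξ e ∧ ξ e ≤ c e) ∧
    (∀ Q : G.Walk s t, wc (fun e => if e ∈ P1.edges ∧ e ∈ P2.edges then ξ e else c e) P1 ≤
      wc (fun e => if e ∈ P1.edges ∧ e ∈ P2.edges then ξ e else c e) Q) ∧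
    (∀ Q : G.Walk s' t', wc (fun e => if e ∈ P1.edges ∧ e ∈ P2.edges then c e - ξ e else c e) P2 ≤
      wc (fun e => if e ∈ P1.edges ∧ e ∈ P2.edges then c e - ξ e else c e) Q)

theorem Prices.rev {P1 : G.Walk s t} {P2 : G.Walk s' t'} (h : Prices c P1 P2.reverse) :
    Prices c P1 P2 := by
  obtain ⟨ξ, h1, h2, h3⟩ := h
  simp only [mer] at h1 h2 h3
  refine ⟨ξ, h1, h2, fun Q => ?_⟩
  have := h3 Q.reverse
  rwa [wc_reverse, wc_reverse] at this

theorem cost_union (c0 : ∀ e, 0 ≤ c e) {F : Finset (Sym2 V)} {P1 : G.Walk s t} {P2 : G.Walk s' t'}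
    (h1 : P1.IsPath) (h2 : P2.IsPath) (e1 : ∀ e ∈ P1.edges, e ∈ F) (e2 : ∀ e ∈ P2.edges, e ∈ F)
    (m : Finset (Sym2 V)) (hm : ∀ e, e ∈ P1.edges → e ∈ P2.edges → e ∈ m) :
    wc c P1 + wc c P2 ≤ cost c F + ∑ e ∈ m, c e := by
  rw [wc_path P1 h1, wc_path P2 h2, ← Finset.sum_union_inter]
  refine add_le_add ?_ ?_
  · refine Finset.sum_le_sum_of_subset_of_nonneg ?_ (fun e _ _ => c0 e)
    intro e; simp only [Finset.mem_union, List.mem_toFinset]; grind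
  · refine Finset.sum_le_sum_of_subset_of_nonneg ?_ (fun e _ _ => c0 e)
    intro e; simp only [Finset.mem_inter, List.mem_toFinset]; grind

/-- consistently oriented case -/
theorem prices_shape [Finite V] (c0 : ∀ e, 0 ≤ c e) (hn : ¬ ContainsBC G s t s' t')
    {F : Finset (Sym2 V)} (hF : IsOptimalSteinerForest G s t s' t' c F)
    (S : Shape G s t s' t')
    (e1 : ∀ e ∈ ((S.L.append S.M).append S.R).edges, e ∈ F)
    (e2 : ∀ e ∈ ((S.L'.append S.M).append S.R').edges, e ∈ F) :
    Prices c ((S.L.append S.M).append S.R) ((S.L'.append S.M).append S.R') := by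
  let I : Inst c G s t s' t' :=
    { S with
      c0 := c0
      opt := by
        intro P Q E hP hQ
        have h1 := opt_le c0 hF P Q E hP hQ
        have h2 := cost_union c0 S.hA S.hB e1 e2 S.M.edges.toFinset
          (fun e h h' => by simpa using S.emeet e h h')
        rw [← wc_path S.M S.pM] at h2
        simp only [wc_append] at h2
        linarith
      nobc := hn }
  obtain ⟨ξ, h1, h2, h3⟩ := core I
  have hiff : ∀ e, (e ∈ ((S.L.append S.M).append S.R).edges ∧
      e ∈ ((S.L'.append S.M).append S.R').edges) ↔ e ∈ I.M.edges := by
    intro e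
    constructor
    · rintro ⟨h, h'⟩; exact S.emeet e h h'
    · intro h
      have h' : e ∈ S.M.edges := h
      simp only [mea]; tauto
  refine ⟨ξ, fun e h h' => h1 e ((hiff e).1 ⟨h, h'⟩), ?_, ?_⟩
  · simp only [hiff]; exact h2
  · simp only [hiff]; exact h3

theorem mk_shape {F : Finset (Sym2 V)} (hac : (fromEdgeSet (↑F : Set (Sym2 V))).IsAcyclic)
    {a b : V} {L : G.Walk s a} {M : G.Walk a b} {R : G.Walk b t}
    {L' : G.Walk s' a} {Y : G.Walk a b} {R' : G.Walk b t'}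
    (h1 : (L.append (M.append R)).IsPath) (h2 : (L'.append (Y.append R')).IsPath)
    (e1 : ∀ e ∈ (L.append (M.append R)).edges, e ∈ F)
    (e2 : ∀ e ∈ (L'.append (Y.append R')).edges, e ∈ F) (hab : a ≠ b)
    (f1 : ∀ z ∈ L.support, z ∈ (L'.append (Y.append R')).support → z = a)
    (f2 : ∀ z ∈ R.support, z ∈ (L'.append (Y.append R')).support → z = b) :
    M = Y ∧ ∃ S : Shape G s t s' t', L.append (M.append R) = (S.L.append S.M).append S.R ∧
      L'.append (Y.append R') = (S.L'.append S.M).append S.R' := by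
  have p1 := path_append.mp (path_append.mp h1).2.1
  have p2 := path_append.mp (path_append.mp h2).2.1
  have hMY : M = Y := by
    refine unique_in_acyclic hac p1.1 p2.1 ?_ ?_
    · intro e he; exact e1 e (by simp only [mea]; tauto)
    · intro e he; exact e2 e (by simp only [mea]; tauto)
  subst hMY
  refine ⟨rfl, ⟨a, b, L, M, R, L', R', by rwa [← Walk.append_assoc],
    by rwa [← Walk.append_assoc], hab, ?_, ?_, ?_, ?_⟩, Walk.append_assoc _ _ _,
    Walk.append_assoc _ _ _⟩
  · intro x hx hx'; exact f1 x hx (by simp only [msa]; tauto)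
  · intro x hx hx'; exact f2 x hx (by simp only [msa]; tauto)
  · intro x hx hx'
    have := f1 x hx (by simp only [msa]; tauto)
    subst this
    exact hab (p2.2.2 _ (Walk.start_mem_support _) hx')
  · intro x hx hx'
    have := f2 x hx (by simp only [msa]; tauto)
    subst this
    exact hab ((path_append.mp h2).2.2 _ hx' (by simp [msa])).symm

theorem containsBC_flip (h : ContainsBC G s t t' s') : ContainsBC G s t s' t' := by
  unfold ContainsBC at *; tauto

theorem opt_flip {F : Finset (Sym2 V)} (h : IsOptimalSteinerForest G s t s' t' c F) :
    IsOptimalSteinerForest G s t t' s' c F := by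
  have key : ∀ (x y : V) (F : Finset (Sym2 V)), IsSteinerForest G s t x y F →
      IsSteinerForest G s t y x F := by
    rintro x y F ⟨h1, h2, h3, p, hp, hp'⟩
    exact ⟨h1, h2, h3, p.reverse, hp.reverse, fun e he => hp' e (mer.1 he)⟩
  exact ⟨key _ _ _ h.1, fun F' hF' => h.2 F' (key _ _ _ hF')⟩

theorem prices [Finite V] (c0 : ∀ e, 0 ≤ c e) (hn : ¬ ContainsBC G s t s' t')
    {F : Finset (Sym2 V)} (hF : IsOptimalSteinerForest G s t s' t' c F)
    (P1 : G.Walk s t) (P2 : G.Walk s' t') (h1 : P1.IsPath) (h2 : P2.IsPath)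
    (e1 : ∀ e ∈ P1.edges, e ∈ F) (e2 : ∀ e ∈ P2.edges, e ∈ F) : Prices c P1 P2 := by
  by_cases hsh : ∃ e, e ∈ P1.edges ∧ e ∈ P2.edges
  · obtain ⟨e, he1, he2⟩ := hsh
    induction e using Sym2.ind with
    | _ v w =>
    have hvw : v ≠ w := (P1.adj_of_mem_edges he1).ne
    have hv1 := P1.fst_mem_support_of_mem_edges he1
    have hv2 := P2.fst_mem_support_of_mem_edges he2
    have hw1 := P1.snd_mem_support_of_mem_edges he1
    have hw2 := P2.snd_mem_support_of_mem_edges he2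
    obtain ⟨a, L, X, rfl, ha, f1⟩ := first_hit (· ∈ P2.support) P1 ⟨v, hv1, hv2⟩
    obtain ⟨b, M, R, rfl, hb, f2⟩ := last_hit (· ∈ P2.support) X
      ⟨a, Walk.start_mem_support _, ha⟩
    have hab : a ≠ b := by
      rintro rfl
      have hM := closed_nil (path_append.mp (path_append.mp h1).2.1).1
      subst hM
      have : ∀ z, z ∈ (L.append (Walk.nil.append R)).support → z ∈ P2.support → z = a := by
        intro z hz hz'
        simp only [msa, Walk.support_nil, List.mem_singleton] at hz
        rcases hz with h | h | h
        · exact f1 z h hz'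
        · exact h
        · exact f2 z h hz'
      exact hvw ((this v hv1 hv2).trans (this w hw1 hw2).symm)
    rcases split2 ha hb with ⟨L', Y, R', rfl⟩ | ⟨R', Y, L', rfl⟩
    · obtain ⟨-, S, hS1, hS2⟩ := mk_shape hF.1.2.1 h1 h2 e1 e2 hab f1 f2
      rw [hS1] at e1 ⊢
      rw [hS2] at e2 ⊢
      exact prices_shape c0 hn hF S e1 e2
    · apply Prices.rev
      have hr : (R'.append (Y.append L')).reverse =
          L'.reverse.append (Y.reverse.append R'.reverse) := by
        simp [Walk.reverse_append, Walk.append_assoc]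
      have h2' := h2.reverse
      have e2' : ∀ e ∈ (R'.append (Y.append L')).reverse.edges, e ∈ F :=
        fun e he => e2 e (mer.1 he)
      have f1' : ∀ z ∈ L.support, z ∈ (R'.append (Y.append L')).reverse.support → z = a :=
        fun z hz hz' => f1 z hz (msr.1 hz')
      have f2' : ∀ z ∈ R.support, z ∈ (R'.append (Y.append L')).reverse.support → z = b :=
        fun z hz hz' => f2 z hz (msr.1 hz')
      rw [hr] at h2' e2' f1' f2' ⊢
      obtain ⟨-, S, hS1, hS2⟩ := mk_shape hF.1.2.1 h1 h2' e1 e2' hab f1' f2'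
      rw [hS1] at e1 ⊢
      rw [hS2] at e2' ⊢
      exact prices_shape c0 (fun h => hn (containsBC_flip h)) (opt_flip hF) S e1 e2'
  · push Not at hsh
    have hu := cost_union c0 h1 h2 e1 e2 ∅ (fun e h h' => absurd h' (hsh e h))
    have hz : ∀ e, ¬ (e ∈ P1.edges ∧ e ∈ P2.edges) := fun e h => hsh e h.1 h.2
    simp only [Finset.sum_empty, add_zero] at hu
    refine ⟨c, fun e h h' => absurd h' (hsh e h), ?_, ?_⟩
    · intro Q
      simp only [hz, if_false]
      have := opt_le c0 hF Q P2 (Q.edges ++ P2.edges) (by simp) (by simp)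
      rw [lc_append] at this
      change wc c P1 ≤ wc c Q
      simp only [lc_edges] at this
      linarith
    · intro Q
      simp only [hz, if_false]
      have := opt_le c0 hF P1 Q (P1.edges ++ Q.edges) (by simp) (by simp)
      rw [lc_append] at this
      change wc c P2 ≤ wc c Q
      simp only [lc_edges] at this
      linarith

/-- the protocol -/
def proto (c σ : Sym2 V → ℝ) : Protocol G s t s' t' := fun P Q i e =>
  if i = 0 then (if e ∈ P.1.edges then (if e ∈ Q.1.edges then σ e else c e) else 0)
  else (if e ∈ Q.1.edges then (if e ∈ P.1.edges then c e - σ e else c e) else 0)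

theorem usedBy0 (P : Strat G s t) (Q : Strat G s' t') (e : Sym2 V) :
    0 ∈ usedBy P Q e ↔ e ∈ P.1.edges := by
  unfold usedBy; split_ifs <;> simp_all

theorem usedBy1 (P : Strat G s t) (Q : Strat G s' t') (e : Sym2 V) :
    1 ∈ usedBy P Q e ↔ e ∈ Q.1.edges := by
  unfold usedBy; split_ifs <;> simp_all

theorem enforce (c0 : ∀ e, 0 ≤ c e) {P1 : G.Walk s t} {P2 : G.Walk s' t'} (h1 : P1.IsPath)
    (h2 : P2.IsPath) (h : Prices c P1 P2) :
    ∃ Ξ : Protocol G s t s' t', IsSeparable c Ξ ∧ IsPNE Ξ ⟨P1, h1⟩ ⟨P2, h2⟩ := by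
  obtain ⟨ξ, hξ, k1, k2⟩ := h
  let σ : Sym2 V → ℝ := fun e =>
    if e ∈ P1.edges then (if e ∈ P2.edges then ξ e else 0) else c e
  have hσ : ∀ e, 0 ≤ σ e ∧ σ e ≤ c e := by
    intro e
    simp only [σ]
    split_ifs with h h'
    · exact hξ e h h'
    · exact ⟨le_rfl, c0 e⟩
    · exact ⟨c0 e, le_rfl⟩
  have hP : IsPNE (proto (G := G) (s := s) (t := t) (s' := s') (t' := t') c σ)
      ⟨P1, h1⟩ ⟨P2, h2⟩ := by
    constructor
    · have key : ∀ Q : Strat G s t, cost₁ (proto c σ) Q ⟨P2, h2⟩ =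
          wc (fun e => if e ∈ P1.edges ∧ e ∈ P2.edges then ξ e else c e) Q.1 := by
        rintro ⟨Q, hQ⟩
        rw [wc_path Q hQ]
        unfold cost₁
        refine Finset.sum_congr rfl ?_
        intro e he
        rw [List.mem_toFinset] at he
        simp only [proto, σ]
        split_ifs <;> first | rfl | tauto
      intro Q
      rw [key, key]; exact k1 Q.1
    · have key : ∀ Q : Strat G s' t', cost₂ (proto c σ) ⟨P1, h1⟩ Q =
          wc (fun e => if e ∈ P1.edges ∧ e ∈ P2.edges then c e - ξ e else c e) Q.1 := by
        rintro ⟨Q, hQ⟩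
        rw [wc_path Q hQ]
        unfold cost₂
        refine Finset.sum_congr rfl ?_
        intro e he
        rw [List.mem_toFinset] at he
        simp only [proto, σ]
        split_ifs <;> first | rfl | tauto | simp_all
      intro Q
      rw [key, key]; exact k2 Q.1
  refine ⟨proto c σ, ⟨?_, ?_, ⟨_, _, hP⟩, ?_⟩, hP⟩
  · intro P Q i e
    have := hσ e
    have := c0 e
    unfold proto
    split_ifs <;> linarith
  · intro P Q e hne
    unfold usedBy at hne ⊢
    by_cases p : e ∈ P.1.edges <;> by_cases q : e ∈ Q.1.edges <;> simp_all [proto]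
  · intro P Q P' Q' e hu i
    have a0 : e ∈ P.1.edges ↔ e ∈ P'.1.edges := by
      rw [← usedBy0 P Q, ← usedBy0 P' Q', hu]
    have a1 : e ∈ Q.1.edges ↔ e ∈ Q'.1.edges := by
      rw [← usedBy1 P Q, ← usedBy1 P' Q', hu]
    simp only [proto, a0, a1]

theorem main [Finite V] (hn : ¬ ContainsBC G s t s' t') : StronglyEfficient G s t s' t' := by
  intro c c0 F hF
  obtain ⟨hsub, hac, ⟨P1, h1, e1⟩, ⟨P2, h2, e2⟩⟩ := hF.1
  refine ⟨⟨P1, h1⟩, ⟨P2, h2⟩, e1, e2, ?_, ?_, enforce c0 h1 h2 (prices c0 hn hF P1 P2 h1 h2 e1 e2)⟩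
  · rintro ⟨Q, hQ⟩ hq
    exact Subtype.ext (unique_in_acyclic hac hQ h1 hq e1)
  · rintro ⟨Q, hQ⟩ hq
    exact Subtype.ext (unique_in_acyclic hac hQ h2 hq e2)

end NDG
end Part14

namespace NDG
variable {V : Type*} [DecidableEq V]

/-- If `(G,(s₁,t₁),(s₂,t₂))` contains no subgraph which is a
bad configuration, then it is strongly efficient: for every nonnegative cost
function, every optimal Steiner forest is enforceable. -/
theorem no_bc_implies_strongly_efficient [Fintype V] (G : SimpleGraph V)
    (s₁ t₁ s₂ t₂ : V) (h : ¬ ContainsBC G s₁ t₁ s₂ t₂) :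
    StronglyEfficient G s₁ t₁ s₂ t₂ := by
  exact main h

end NDG
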